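/- Let d ≥ 1 and m > 0, and define the relative Fisher information (with respect to the p-variable) of a probability measure ν on ℝ^{2d} = ℝ^d_q × ℝ^d_p by I(ν|μ) := sup over φ ∈ C_c^∞(ℝ^{2d}) of 2∫_{ℝ^{2d}} [Δ_p φ − (p/m)·∇_p φ − (1/2)|∇_p φ|²] dν. If ν ∈ P(ℝ^{2d}) is absolutely continuous with Lebesgue density f ∈ L¹(ℝ^{2d}), then: (i) if the distributional gradient ∇_p f (gradient in the p-variables only, characterized by ∫ f ∇_p φ = −∫ (∇_p f) φ for all φ ∈ C_c^∞) belongs to L¹_loc(ℝ^{2d}), one has I(ν|μ) = ∫_{ℝ^{2d}} |(∇_p f / f)·1_{{f>0}} + p/m|² f dq dp; (ii) otherwise I(ν|μ) = +∞. -/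

import Mathlib

open MeasureTheory Real Filter Topology Set
open scoped ENNReal NNReal

noncomputable section

/-- Phase space ℝ^{2d} = ℝ^d_q × ℝ^d_p. -/
abbrev Phase (d : ℕ) := (Fin d → ℝ) × (Fin d → ℝ)

/-- The unit direction in the `p_i` coordinate. -/
def dirP {d : ℕ} (i : Fin d) : Phase d := (0, Pi.single i 1)

/-- Partial derivative in the `p_i` variable. -/
def pdP {d : ℕ} (φ : Phase d → ℝ) (x : Phase d) (i : Fin d) : ℝ :=
  fderiv ℝ φ x (dirP i)

/-- The Laplacian in the `p` variables. -/
def laplP {d : ℕ} (φ : Phase d → ℝ) (x : Phase d) : ℝ :=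
  ∑ i, fderiv ℝ (fun y => pdP φ y i) x (dirP i)

/-- `φ ∈ C_c^∞(ℝ^{2d})`. -/
def IsTestFn {d : ℕ} (φ : Phase d → ℝ) : Prop :=
  ContDiff ℝ (⊤ : ℕ∞) φ ∧ HasCompactSupport φ

/-- The integrand `Δ_p φ − (p/m)·∇_p φ − ½|∇_p φ|²` in the duality definition of the
relative Fisher information. -/
def fisherIntegrand {d : ℕ} (m : ℝ) (φ : Phase d → ℝ) (x : Phase d) : ℝ :=
  laplP φ x - (1 / m) * ∑ i, x.2 i * pdP φ x i - (1 / 2) * ∑ i, (pdP φ x i) ^ 2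

/-- The relative Fisher information (w.r.t. the `p`-variable) of a measure `ν` on ℝ^{2d},
`I(ν|μ) := sup_{φ ∈ C_c^∞} 2∫ [Δ_p φ − (p/m)·∇_p φ − ½|∇_p φ|²] dν`, as a value in `[0,∞]`
(the supremum contains `φ = 0`, so passing through `ENNReal.ofReal` loses nothing). -/
def relFisher {d : ℕ} (m : ℝ) (ν : Measure (Phase d)) : ℝ≥0∞ :=
  ⨆ φ : {φ : Phase d → ℝ // IsTestFn φ},
    ENNReal.ofReal (2 * ∫ x, fisherIntegrand m φ.1 x ∂ν)

/-- `G` is the distributional gradient of `f` in the `p`-variables, with `G ∈ L¹_loc`. -/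
def IsWeakPGrad {d : ℕ} (f : Phase d → ℝ) (G : Phase d → Fin d → ℝ) : Prop :=
  (∀ i, LocallyIntegrable (fun x => G x i) volume) ∧
  ∀ φ : Phase d → ℝ, IsTestFn φ → ∀ i,
    ∫ x, f x * pdP φ x i = - ∫ x, G x i * φ x

section Basics

variable {d : ℕ}

instance : (volume : Measure (Phase d)).IsAddHaarMeasure :=
  Measure.prod.instIsAddHaarMeasure _ _

lemma ContDiff.pdP {φ : Phase d → ℝ} (h : ContDiff ℝ (⊤ : ℕ∞) φ) (i : Fin d) :
    ContDiff ℝ (⊤ : ℕ∞) (fun x => pdP φ x i) :=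
  (h.fderiv_right (m := (⊤ : ℕ∞)) (by simp)).clm_apply contDiff_const

lemma IsTestFn.pdP {φ : Phase d → ℝ} (h : IsTestFn φ) (i : Fin d) :
    IsTestFn (fun x => pdP φ x i) :=
  ⟨ContDiff.pdP h.1 i, h.2.fderiv_apply ℝ (dirP i)⟩

lemma IsTestFn.add {φ ψ : Phase d → ℝ} (hφ : IsTestFn φ) (hψ : IsTestFn ψ) :
    IsTestFn (φ + ψ) := ⟨hφ.1.add hψ.1, hφ.2.add hψ.2⟩

lemma IsTestFn.const_mul {φ : Phase d → ℝ} (hφ : IsTestFn φ) (c : ℝ) :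
    IsTestFn (fun x => c * φ x) := ⟨contDiff_const.mul hφ.1, hφ.2.mul_left⟩

lemma IsTestFn.neg {φ : Phase d → ℝ} (hφ : IsTestFn φ) :
    IsTestFn (fun x => -φ x) := ⟨hφ.1.neg, hφ.2.comp_left (g := fun t : ℝ => -t) (by simp)⟩

lemma IsTestFn.zero : IsTestFn (fun _ : Phase d => (0 : ℝ)) :=
  ⟨contDiff_const, HasCompactSupport.zero⟩

lemma IsTestFn.mul_smooth {φ ψ : Phase d → ℝ} (hφ : IsTestFn φ) (hψ : ContDiff ℝ (⊤ : ℕ∞) ψ) :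
    IsTestFn (fun x => φ x * ψ x) := ⟨hφ.1.mul hψ, hφ.2.mul_right⟩

lemma IsTestFn.comp_add_right {φ : Phase d → ℝ} (hφ : IsTestFn φ) (y : Phase d) :
    IsTestFn (fun x => φ (x + y)) :=
  ⟨hφ.1.comp (contDiff_id.add contDiff_const), hφ.2.comp_homeomorph (Homeomorph.addRight y)⟩

lemma IsTestFn.integrable_mul {φ f : Phase d → ℝ} (hφ : IsTestFn φ)
    (hf : LocallyIntegrable f volume) : Integrable (fun x => f x * φ x) := by
  have := hf.integrable_smul_right_of_hasCompactSupport hφ.1.continuous hφ.2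
  simpa [smul_eq_mul] using this

lemma exists_bound_of_hasCompactSupport {k : Phase d → ℝ} (hk : Continuous k)
    (hc : HasCompactSupport k) : ∃ C, 0 ≤ C ∧ ∀ x, |k x| ≤ C := by
  obtain ⟨C, hC⟩ := hc.exists_bound_of_continuous hk
  exact ⟨C, (norm_nonneg _).trans (hC 0), hC⟩

lemma IsTestFn.exists_bound {φ : Phase d → ℝ} (hφ : IsTestFn φ) :
    ∃ C, 0 ≤ C ∧ ∀ x, |φ x| ≤ C :=
  exists_bound_of_hasCompactSupport hφ.1.continuous hφ.2

lemma pdP_add {φ ψ : Phase d → ℝ} {x : Phase d} (hφ : DifferentiableAt ℝ φ x)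
    (hψ : DifferentiableAt ℝ ψ x) (i : Fin d) :
    pdP (fun y => φ y + ψ y) x i = pdP φ x i + pdP ψ x i := by
  simp [pdP, fderiv_fun_add hφ hψ]

lemma pdP_const_mul {φ : Phase d → ℝ} {x : Phase d} (c : ℝ) (i : Fin d) :
    pdP (fun y => c * φ y) x i = c * pdP φ x i := by
  have : (fun y => c * φ y) = c • φ := by ext; simp
  simp [pdP, this, fderiv_const_smul_field]

lemma pdP_neg {φ : Phase d → ℝ} {x : Phase d} (i : Fin d) :
    pdP (fun y => - φ y) x i = - pdP φ x i := by
  simp [pdP, fderiv_fun_neg]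

lemma pdP_mul {φ ψ : Phase d → ℝ} {x : Phase d} (hφ : DifferentiableAt ℝ φ x)
    (hψ : DifferentiableAt ℝ ψ x) (i : Fin d) :
    pdP (fun y => φ y * ψ y) x i = φ x * pdP ψ x i + ψ x * pdP φ x i := by
  simp [pdP, fderiv_fun_mul hφ hψ]

lemma pdP_comp {φ : Phase d → ℝ} {h : ℝ → ℝ} {h' : ℝ} {x : Phase d}
    (hh : HasDerivAt h h' (φ x)) (hφ : DifferentiableAt ℝ φ x) (i : Fin d) :
    pdP (fun y => h (φ y)) x i = h' * pdP φ x i := by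
  have := hh.comp_hasFDerivAt x hφ.hasFDerivAt
  simp only [pdP]
  rw [show (fun y => h (φ y)) = h ∘ φ from rfl, this.fderiv]
  simp

lemma pdP_comp_add_right (φ : Phase d → ℝ) (x y : Phase d) (i : Fin d) :
    pdP (fun z => φ (z + y)) x i = pdP φ (x + y) i := by
  simp [pdP, fderiv_comp_add_right]

lemma pdP_snd (x : Phase d) (i j : Fin d) :
    pdP (fun y : Phase d => y.2 j) x i = if i = j then 1 else 0 := by
  have : (fun y : Phase d => y.2 j) =
      ((ContinuousLinearMap.proj j).comp (ContinuousLinearMap.snd ℝ (Fin d → ℝ) (Fin d → ℝ))) := rfl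
  simp only [pdP]
  rw [this, ContinuousLinearMap.fderiv]
  simp [dirP, Pi.single_apply, eq_comm]

lemma contDiff_snd_apply (j : Fin d) : ContDiff ℝ (⊤ : ℕ∞) (fun y : Phase d => y.2 j) :=
  (contDiff_apply ℝ ℝ j).comp contDiff_snd

/-- Integration by parts in the variable `p_i`. -/
lemma integral_mul_pdP {f g : Phase d → ℝ} (i : Fin d) (hf : Differentiable ℝ f)
    (hg : Differentiable ℝ g) (h1 : Integrable (fun x => pdP f x i * g x))
    (h2 : Integrable (fun x => f x * pdP g x i)) (h3 : Integrable (fun x => f x * g x)) :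
    ∫ x, f x * pdP g x i = - ∫ x, pdP f x i * g x :=
  integral_mul_fderiv_eq_neg_fderiv_mul_of_integrable h1 h2 h3
    (fun x _ => hf x) (fun x _ => hg x)

end Basics

section FieldTerms

variable {d : ℕ}

/-- The contribution of the `i`-th component `ψ` of a test vector field to the dual functional,
where no regularity of the density `f` is required. -/
def weakTerm (m : ℝ) (f : Phase d → ℝ) (i : Fin d) (ψ : Phase d → ℝ) : ℝ :=
  ∫ x, f x * (-2 * pdP ψ x i + 2 * (x.2 i / m) * ψ x - ψ x ^ 2)

/-- The contribution of the `i`-th component `Y` of a vector field to the dual functional,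
for a differentiable density `f`. -/
def fieldTerm (m : ℝ) (f : Phase d → ℝ) (i : Fin d) (Y : Phase d → ℝ) : ℝ :=
  ∫ x, (2 * (pdP f x i + f x * (x.2 i / m)) * Y x - f x * Y x ^ 2)

lemma IsTestFn.weakTerm_kernel {ψ : Phase d → ℝ} (hψ : IsTestFn ψ) (m : ℝ) (i : Fin d) :
    IsTestFn (fun x => -2 * _root_.pdP ψ x i + 2 * (x.2 i / m) * ψ x - ψ x ^ 2) := by
  have h1 := (hψ.pdP i).const_mul (-2)
  have h2 : IsTestFn (fun x => ψ x * (2 * (x.2 i / m) - ψ x)) :=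
    hψ.mul_smooth ((contDiff_const.mul ((contDiff_snd_apply i).div_const m)).sub hψ.1)
  convert h1.add h2 using 1
  ext x
  simp only [Pi.add_apply]
  ring

lemma two_mul_integral_fisherIntegrand (m : ℝ) {f : Phase d → ℝ}
    (hf : LocallyIntegrable f volume) {φ : Phase d → ℝ} (hφ : IsTestFn φ) :
    2 * ∫ x, f x * fisherIntegrand m φ x = ∑ i, weakTerm m f i (fun x => - pdP φ x i) := by
  unfold weakTerm
  rw [← integral_const_mul, ← integral_finsetSum]
  · congr 1
    ext x
    rw [← Finset.mul_sum]
    simp only [fisherIntegrand, laplP, pdP_neg, Finset.mul_sum, ← Finset.sum_sub_distrib]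
    refine Finset.sum_congr rfl fun i _ => ?_
    simp only [pdP]
    ring
  · intro i _
    exact ((hφ.pdP i).neg.weakTerm_kernel m i).integrable_mul hf

lemma weakTerm_eq_fieldTerm (m : ℝ) {f : Phase d → ℝ} (hf : ContDiff ℝ (⊤ : ℕ∞) f)
    (i : Fin d) {ψ : Phase d → ℝ} (hψ : IsTestFn ψ) :
    weakTerm m f i ψ = fieldTerm m f i ψ := by
  have hl : LocallyIntegrable f volume := hf.continuous.locallyIntegrable
  have hl' : LocallyIntegrable (fun x => pdP f x i) volume :=
    (ContDiff.pdP hf i).continuous.locallyIntegrable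
  have i1 := (hψ.pdP i).integrable_mul hl
  have i2 := hψ.integrable_mul hl'
  have i3 : Integrable (fun x => f x * (ψ x * (2 * (x.2 i / m) - ψ x))) :=
    (hψ.mul_smooth ((contDiff_const.mul ((contDiff_snd_apply i).div_const m)).sub hψ.1)
      ).integrable_mul hl
  have key := integral_mul_pdP i (hf.differentiable (by simp)) (hψ.1.differentiable (by simp))
    i2 i1 (hψ.integrable_mul hl)
  calc weakTerm m f i ψ
      = ∫ x, (-2 * (f x * pdP ψ x i) + f x * (ψ x * (2 * (x.2 i / m) - ψ x))) := by
        unfold weakTerm; congr 1; ext x; ring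
    _ = 2 * (∫ x, pdP f x i * ψ x) + ∫ x, f x * (ψ x * (2 * (x.2 i / m) - ψ x)) := by
        rw [integral_add (i1.const_mul _) i3, integral_const_mul, key]; ring
    _ = fieldTerm m f i ψ := by
        rw [← integral_const_mul, ← integral_add (i2.const_mul _) i3]
        unfold fieldTerm; congr 1; ext x; ring

lemma exists_cutoff (d : ℕ) : ∃ χ : ℕ → Phase d → ℝ, (∀ n, IsTestFn (χ n)) ∧
    (∀ n x, |χ n x| ≤ 1) ∧ (∀ x, Tendsto (fun n => χ n x) atTop (𝓝 1)) ∧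
    ∃ C, 0 ≤ C ∧ ∀ n x i, |pdP (χ n) x i| ≤ C / (n + 1) ∧ |x.2 i * pdP (χ n) x i| ≤ C := by
  let b : ContDiffBump (0 : Phase d) := ⟨1, 2, one_pos, one_lt_two⟩
  have hb : IsTestFn (b : Phase d → ℝ) := ⟨b.contDiff, b.hasCompactSupport⟩
  have hb1 : ∀ i, ∃ C, 0 ≤ C ∧ ∀ x, |pdP b x i| ≤ C := fun i => (hb.pdP i).exists_bound
  have hb2 : ∀ i, ∃ C, 0 ≤ C ∧ ∀ x, |pdP b x i * x.2 i| ≤ C := fun i =>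
    ((hb.pdP i).mul_smooth (contDiff_snd_apply i)).exists_bound
  choose C1 hC1 hC1' using hb1
  choose C2 hC2 hC2' using hb2
  have hpos : ∀ n : ℕ, (0 : ℝ) < n + 1 := fun n => by positivity
  have hpd : ∀ (n : ℕ) (x : Phase d) (i : Fin d),
      pdP (fun y => b (((n : ℝ) + 1)⁻¹ • y)) x i
        = ((n : ℝ) + 1)⁻¹ * pdP b (((n : ℝ) + 1)⁻¹ • x) i := by
    intro n x i
    simp only [pdP]
    rw [fderiv_comp_smul]
    simp
  refine ⟨fun n x => b (((n : ℝ) + 1)⁻¹ • x), fun n => ?_, fun n x => ?_, fun x => ?_,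
    ∑ i, C1 i + ∑ i, C2 i, ?_, fun n x i => ⟨?_, ?_⟩⟩
  · exact ⟨hb.1.comp (contDiff_const_smul _), hb.2.comp_smul (inv_ne_zero (hpos n).ne')⟩
  · rw [abs_of_nonneg b.nonneg]
    exact b.le_one
  · have h1 : Tendsto (fun n : ℕ => ((n : ℝ) + 1)⁻¹ • x) atTop (𝓝 ((0 : ℝ) • x)) :=
      (tendsto_inv_atTop_zero.comp (tendsto_atTop_add_const_right _ 1
        tendsto_natCast_atTop_atTop)).smul_const x
    rw [zero_smul] at h1
    have h2 := (b.continuous.tendsto 0).comp h1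
    have h3 : b 0 = 1 := b.one_of_mem_closedBall (by simp [b])
    rwa [h3] at h2
  · exact add_nonneg (Finset.sum_nonneg fun i _ => hC1 i) (Finset.sum_nonneg fun i _ => hC2 i)
  · rw [hpd, abs_mul, abs_of_pos (inv_pos.2 (hpos n)), div_eq_inv_mul]
    refine mul_le_mul_of_nonneg_left ?_ (inv_pos.2 (hpos n)).le
    refine (hC1' i _).trans ((Finset.single_le_sum (fun i _ => hC1 i) (Finset.mem_univ i)).trans ?_)
    linarith [Finset.sum_nonneg fun i (_ : i ∈ Finset.univ) => hC2 i]
  · rw [hpd]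
    have h := hC2' i (((n : ℝ) + 1)⁻¹ • x)
    have e : x.2 i * (((n : ℝ) + 1)⁻¹ * pdP b (((n : ℝ) + 1)⁻¹ • x) i)
      = pdP b (((n : ℝ) + 1)⁻¹ • x) i * (((n : ℝ) + 1)⁻¹ • x).2 i := by
      simp only [Prod.smul_snd, Pi.smul_apply, smul_eq_mul]; ring
    rw [e]
    refine h.trans ((Finset.single_le_sum (fun i _ => hC2 i) (Finset.mem_univ i)).trans ?_)
    linarith [Finset.sum_nonneg fun i (_ : i ∈ Finset.univ) => hC1 i]

/-- A smooth nonnegative integrable density, bounded and with bounded and integrable first-order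
derivatives in the variables `p`. -/
structure SmoothDensity (f : Phase d → ℝ) : Prop where
  contDiff : ContDiff ℝ (⊤ : ℕ∞) f
  nonneg : ∀ x, 0 ≤ f x
  integrable : Integrable f
  bounded : ∃ M, ∀ x, f x ≤ M
  integrable_pdP : ∀ i, Integrable (fun x => pdP f x i)
  bounded_pdP : ∃ M, ∀ x i, |pdP f x i| ≤ M

lemma tendsto_fieldTerm_cutoff {m : ℝ} {f : Phase d → ℝ} (hf : SmoothDensity f)
    {χ : ℕ → Phase d → ℝ} (hχ : ∀ n, IsTestFn (χ n)) (hχ1 : ∀ n x, |χ n x| ≤ 1)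
    (hχt : ∀ x, Tendsto (fun n => χ n x) atTop (𝓝 1)) {C : ℝ} (hC : 0 ≤ C)
    (hχC : ∀ n x i, |pdP (χ n) x i| ≤ C / (n + 1) ∧ |x.2 i * pdP (χ n) x i| ≤ C)
    {φ : Phase d → ℝ} (hφ : ContDiff ℝ (⊤ : ℕ∞) φ) {B : ℝ} (hB : ∀ x, |φ x| ≤ B)
    (i : Fin d) (hB' : ∀ x, |pdP φ x i| ≤ B)
    (hi : Integrable (fun x => f x * (x.2 i * pdP φ x i))) :
    Tendsto (fun n => fieldTerm m f i (fun x => - pdP (fun y => χ n y * φ y) x i)) atTop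
      (𝓝 (fieldTerm m f i (fun x => - pdP φ x i))) := by
  have hB0 : 0 ≤ B := (abs_nonneg _).trans (hB 0)
  have hpd : ∀ n x, pdP (fun y => χ n y * φ y) x i
      = χ n x * pdP φ x i + φ x * pdP (χ n) x i := fun n x =>
    pdP_mul ((hχ n).1.differentiable (by simp) x) (hφ.differentiable (by simp) x) i
  have hn1 : ∀ n : ℕ, (1 : ℝ) ≤ n + 1 := fun n => by
    have : (0 : ℝ) ≤ n := n.cast_nonneg
    linarith
  have hχC1 : ∀ n x, |pdP (χ n) x i| ≤ C := fun n x =>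
    (hχC n x i).1.trans (div_le_self hC (hn1 n))
  have hY : ∀ n x, |pdP (fun y => χ n y * φ y) x i| ≤ B + B * C := by
    intro n x
    rw [hpd]
    refine (abs_add_le _ _).trans (add_le_add ?_ ?_)
    · rw [abs_mul]
      calc _ ≤ 1 * B := mul_le_mul (hχ1 n x) (hB' x) (abs_nonneg _) zero_le_one
        _ = B := one_mul B
    · rw [abs_mul]
      exact mul_le_mul (hB x) (hχC1 n x) (abs_nonneg _) hB0
  have hPY : ∀ n x, |x.2 i * pdP (fun y => χ n y * φ y) x i|
      ≤ |x.2 i * pdP φ x i| + B * C := by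
    intro n x
    have e : x.2 i * pdP (fun y => χ n y * φ y) x i
      = χ n x * (x.2 i * pdP φ x i) + φ x * (x.2 i * pdP (χ n) x i) := by rw [hpd]; ring
    rw [e]
    refine (abs_add_le _ _).trans (add_le_add ?_ ?_)
    · rw [abs_mul]
      exact mul_le_of_le_one_left (abs_nonneg _) (hχ1 n x)
    · rw [abs_mul]
      exact mul_le_mul (hB x) (hχC n x i).2 (abs_nonneg _) hB0
  unfold fieldTerm
  refine tendsto_integral_of_dominated_convergence
    (fun x => 2 * (B + B * C) * |pdP f x i| + 2 * |m|⁻¹ * |f x * (x.2 i * pdP φ x i)|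
      + (2 * |m|⁻¹ * (B * C) + (B + B * C) ^ 2) * f x) ?_ ?_ ?_ ?_
  · intro n
    have c1 := (ContDiff.pdP hf.contDiff i).continuous
    have c2 := hf.contDiff.continuous
    have c3 := (contDiff_snd_apply (d := d) i).continuous
    have c4 := (((hχ n).mul_smooth hφ).pdP i).1.continuous
    exact Continuous.aestronglyMeasurable (by fun_prop)
  · exact (((hf.integrable_pdP i).abs.const_mul _).add (hi.abs.const_mul _)).add
      (hf.integrable.const_mul _)
  · intro n
    refine Eventually.of_forall fun x => ?_
    have h0 := hf.nonneg x
    set Y := pdP (fun y => χ n y * φ y) x i with hYdef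
    have h1 : |2 * (pdP f x i) * Y| ≤ 2 * (B + B * C) * |pdP f x i| := by
      rw [abs_mul, abs_mul, abs_two]
      nlinarith [mul_le_mul_of_nonneg_left (hY n x) (abs_nonneg (pdP f x i))]
    have h2 : |2 * (f x * (x.2 i / m)) * Y| ≤ 2 * |m|⁻¹ * |f x * (x.2 i * pdP φ x i)|
        + 2 * |m|⁻¹ * (B * C) * f x := by
      have e : 2 * (f x * (x.2 i / m)) * Y = 2 * m⁻¹ * (f x * (x.2 i * Y)) := by ring
      rw [e, abs_mul, abs_mul, abs_mul (f x), abs_mul (f x), abs_two, abs_inv, abs_of_nonneg h0]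
      have := mul_le_mul_of_nonneg_left (hPY n x) (mul_nonneg (by positivity : 0 ≤ 2 * |m|⁻¹) h0)
      linarith
    have h3 : |f x * Y ^ 2| ≤ (B + B * C) ^ 2 * f x := by
      rw [abs_mul, abs_of_nonneg h0, abs_pow, mul_comm]
      exact mul_le_mul_of_nonneg_right (pow_le_pow_left₀ (abs_nonneg _) (hY n x) 2) h0
    rw [Real.norm_eq_abs]
    calc _ = |2 * (pdP f x i) * (-Y) + 2 * (f x * (x.2 i / m)) * (-Y) - f x * Y ^ 2| := by
            congr 1; ring
      _ ≤ |2 * (pdP f x i) * (-Y)| + |2 * (f x * (x.2 i / m)) * (-Y)| + |f x * Y ^ 2| :=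
            (abs_sub _ _).trans (add_le_add_left (abs_add_le _ _) _)
      _ ≤ _ := by
            rw [mul_neg, mul_neg, abs_neg, abs_neg]
            linarith
  · refine Eventually.of_forall fun x => ?_
    have t1 : Tendsto (fun n => pdP (χ n) x i) atTop (𝓝 0) := by
      refine squeeze_zero_norm (fun n => (hχC n x i).1) ?_
      exact_mod_cast (tendsto_const_div_atTop_nhds_zero_nat C).comp (tendsto_add_atTop_nat 1)
    have t2 : Tendsto (fun n => - pdP (fun y => χ n y * φ y) x i) atTop (𝓝 (- pdP φ x i)) := by
      simp only [hpd]
      simpa using (((hχt x).mul_const (pdP φ x i)).add (t1.const_mul (φ x))).neg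
    exact (t2.const_mul _).sub ((t2.pow 2).const_mul _)

/-- The duality bound for test functions extends to bounded smooth functions with bounded gradient
in the variables `p`. -/
lemma SmoothDensity.sum_fieldTerm_grad_le {m c : ℝ} {f : Phase d → ℝ} (hf : SmoothDensity f)
    (hc : ∀ φ, IsTestFn φ → 2 * ∫ x, f x * fisherIntegrand m φ x ≤ c)
    {φ : Phase d → ℝ} (hφ : ContDiff ℝ (⊤ : ℕ∞) φ) {B : ℝ} (hB : ∀ x, |φ x| ≤ B)
    (hB' : ∀ x i, |pdP φ x i| ≤ B)
    (hi : ∀ i, Integrable (fun x => f x * (x.2 i * pdP φ x i))) :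
    ∑ i, fieldTerm m f i (fun x => - pdP φ x i) ≤ c := by
  obtain ⟨χ, hχ, hχ1, hχt, C, hC, hχC⟩ := exists_cutoff d
  refine le_of_tendsto (tendsto_finsetSum Finset.univ fun i _ =>
    tendsto_fieldTerm_cutoff hf hχ hχ1 hχt hC hχC hφ hB i (fun x => hB' x i) (hi i)) ?_
  refine Eventually.of_forall fun n => ?_
  have ht := (hχ n).mul_smooth hφ
  have := hc _ ht
  rw [two_mul_integral_fisherIntegrand m hf.contDiff.continuous.locallyIntegrable ht] at this
  simpa only [fun i => weakTerm_eq_fieldTerm m hf.contDiff i (ht.pdP i).neg] using this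

end FieldTerms

section Damping

variable {d : ℕ}

/-- Half the squared Euclidean norm of the momentum. -/
def halfSq (x : Phase d) : ℝ := (∑ j, x.2 j ^ 2) / 2

/-- The reciprocal of `1 + κ |p|² / 2`. -/
def damp (κ : ℝ) (x : Phase d) : ℝ := (1 + κ * halfSq x)⁻¹

lemma halfSq_nonneg (x : Phase d) : 0 ≤ halfSq x :=
  div_nonneg (Finset.sum_nonneg fun _ _ => sq_nonneg _) zero_le_two

lemma sq_le_halfSq (x : Phase d) (i : Fin d) : x.2 i ^ 2 ≤ 2 * halfSq x := by
  have := Finset.single_le_sum (f := fun j => x.2 j ^ 2) (fun j _ => sq_nonneg _)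
    (Finset.mem_univ i)
  simp only [halfSq]
  linarith

lemma contDiff_halfSq : ContDiff ℝ (⊤ : ℕ∞) (halfSq : Phase d → ℝ) :=
  (ContDiff.sum fun j _ => (contDiff_snd_apply j).pow 2).div_const 2

lemma one_le_damp_base {κ : ℝ} (hκ : 0 < κ) (x : Phase d) : 1 ≤ 1 + κ * halfSq x := by
  have := mul_nonneg hκ.le (halfSq_nonneg x)
  linarith

lemma damp_pos {κ : ℝ} (hκ : 0 < κ) (x : Phase d) : 0 < damp κ x :=
  inv_pos.2 (zero_lt_one.trans_le (one_le_damp_base hκ x))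

lemma damp_le_one {κ : ℝ} (hκ : 0 < κ) (x : Phase d) : damp κ x ≤ 1 :=
  inv_le_one_of_one_le₀ (one_le_damp_base hκ x)

lemma contDiff_damp {κ : ℝ} (hκ : 0 < κ) : ContDiff ℝ (⊤ : ℕ∞) (damp κ : Phase d → ℝ) :=
  (contDiff_const.add (contDiff_const.mul contDiff_halfSq)).inv
    fun x => (zero_lt_one.trans_le (one_le_damp_base hκ x)).ne'

lemma damp_mul_sq_le {κ : ℝ} (hκ : 0 < κ) (x : Phase d) (i : Fin d) :
    κ * (damp κ x * x.2 i ^ 2) ≤ 2 := by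
  have h1 : damp κ x * (1 + κ * halfSq x) = 1 :=
    inv_mul_cancel₀ (zero_lt_one.trans_le (one_le_damp_base hκ x)).ne'
  have h2 := mul_le_mul_of_nonneg_left (sq_le_halfSq x i) (mul_pos hκ (damp_pos hκ x)).le
  nlinarith [damp_pos hκ x]

lemma pdP_halfSq (x : Phase d) (i : Fin d) : pdP halfSq x i = x.2 i := by
  have h : ∀ j, HasFDerivAt (fun y : Phase d => y.2 j ^ 2)
      ((2 * x.2 j) • fderiv ℝ (fun y : Phase d => y.2 j) x) x := by
    intro j
    have := (((contDiff_snd_apply j).differentiable (by simp)).differentiableAt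
      (x := x)).hasFDerivAt.pow 2
    simpa using this
  have h2 := (HasFDerivAt.fun_sum fun j (_ : j ∈ Finset.univ) => h j).mul_const (2⁻¹ : ℝ)
  have h3 : (halfSq : Phase d → ℝ) = fun y => (∑ j, y.2 j ^ 2) * 2⁻¹ := by
    ext y; simp [halfSq, div_eq_mul_inv]
  have h4 : ∀ j, (fderiv ℝ (fun y : Phase d => y.2 j) x) (dirP i) = if i = j then 1 else 0 :=
    fun j => pdP_snd x i j
  simp only [pdP]
  rw [h3, h2.fderiv]
  simp [h4]

lemma pdP_damp {κ : ℝ} (hκ : 0 < κ) (x : Phase d) (i : Fin d) :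
    pdP (damp κ) x i = - (κ * damp κ x ^ 2 * x.2 i) := by
  have hb : (1 + κ * halfSq x) ≠ 0 := (zero_lt_one.trans_le (one_le_damp_base hκ x)).ne'
  have h : HasDerivAt (fun t : ℝ => (1 + κ * t)⁻¹) (-κ / (1 + κ * halfSq x) ^ 2) (halfSq x) := by
    have := (((hasDerivAt_id (halfSq x)).const_mul κ).const_add 1).fun_inv hb
    simpa using this
  have := pdP_comp h (contDiff_halfSq.differentiable (by simp) x) i
  change pdP (fun y => (1 + κ * halfSq y)⁻¹) x i = _
  rw [this, pdP_halfSq]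
  simp only [damp]
  field_simp

/-- A bounded truncation of `|p|² / 2`, up to an additive constant. -/
def dampPot (κ : ℝ) (x : Phase d) : ℝ := -κ⁻¹ * damp κ x

lemma contDiff_dampPot {κ : ℝ} (hκ : 0 < κ) : ContDiff ℝ (⊤ : ℕ∞) (dampPot κ : Phase d → ℝ) :=
  contDiff_const.mul (contDiff_damp hκ)

lemma pdP_dampPot {κ : ℝ} (hκ : 0 < κ) (x : Phase d) (i : Fin d) :
    pdP (dampPot κ) x i = damp κ x ^ 2 * x.2 i := by
  unfold dampPot
  rw [pdP_const_mul, pdP_damp hκ]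
  field_simp

lemma abs_dampPot_le {κ : ℝ} (hκ : 0 < κ) (x : Phase d) : |dampPot κ x| ≤ κ⁻¹ := by
  unfold dampPot
  rw [abs_mul, abs_neg, abs_of_pos (inv_pos.2 hκ), abs_of_pos (damp_pos hκ x)]
  exact mul_le_of_le_one_right (inv_pos.2 hκ).le (damp_le_one hκ x)

lemma damp_sq_mul_sq_le {κ : ℝ} (hκ : 0 < κ) (x : Phase d) (i : Fin d) :
    damp κ x ^ 2 * x.2 i ^ 2 ≤ 2 * κ⁻¹ := by
  have h1 := damp_mul_sq_le hκ x i
  have h2 : damp κ x * x.2 i ^ 2 ≤ 2 * κ⁻¹ := by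
    rw [← div_eq_mul_inv, le_div_iff₀ hκ]; linarith
  refine le_trans ?_ h2
  have h3 := damp_le_one hκ x
  have h4 := damp_pos hκ x
  refine mul_le_mul_of_nonneg_right ?_ (sq_nonneg _)
  nlinarith

lemma abs_damp_sq_mul_le {κ : ℝ} (hκ : 0 < κ) (x : Phase d) (i : Fin d) :
    |damp κ x ^ 2 * x.2 i| ≤ 1 + 2 * κ⁻¹ := by
  have h1 := damp_sq_mul_sq_le hκ x i
  have h2 : damp κ x ^ 2 ≤ 1 := pow_le_one₀ (damp_pos hκ x).le (damp_le_one hκ x)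
  rw [abs_mul, abs_of_nonneg (sq_nonneg (damp κ x))]
  have h3 : |x.2 i| ≤ 1 + x.2 i ^ 2 := by
    rw [← sq_abs]; nlinarith [sq_nonneg (|x.2 i| - 1), abs_nonneg (x.2 i)]
  have := mul_le_mul_of_nonneg_left h3 (sq_nonneg (damp κ x))
  linarith

lemma contDiff_damp_sq_mul {κ : ℝ} (hκ : 0 < κ) (i : Fin d) :
    ContDiff ℝ (⊤ : ℕ∞) (fun x : Phase d => damp κ x ^ 2 * x.2 i) :=
  ((contDiff_damp hκ).pow 2).mul (contDiff_snd_apply i)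

lemma abs_pdP_damp_sq_mul_le {κ : ℝ} (hκ : 0 < κ) (x : Phase d) (i : Fin d) :
    |pdP (fun y => damp κ y ^ 2 * y.2 i) x i| ≤ 5 := by
  have hd : DifferentiableAt ℝ (damp κ) x := (contDiff_damp hκ).differentiable (by simp) x
  rw [pdP_mul (hd.fun_pow 2) ((contDiff_snd_apply i).differentiable (by simp) x) i, pdP_snd, if_pos rfl,
    pdP_comp (h := fun t => t ^ 2) (by simpa using hasDerivAt_pow 2 (damp κ x)) hd, pdP_damp hκ]
  have h1 := damp_mul_sq_le hκ x i
  have h2 := damp_le_one hκ x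
  have h3 := damp_pos hκ x
  have h4 : damp κ x ^ 2 ≤ 1 := pow_le_one₀ h3.le h2
  have e : damp κ x ^ 2 * 1 + x.2 i * (2 * damp κ x * -(κ * damp κ x ^ 2 * x.2 i))
    = damp κ x ^ 2 - 2 * damp κ x ^ 2 * (κ * (damp κ x * x.2 i ^ 2)) := by ring
  rw [e]
  have h5 : 0 ≤ κ * (damp κ x * x.2 i ^ 2) := by positivity
  have h6 := mul_le_mul h4 h1 h5 zero_le_one
  rw [abs_le]
  constructor <;> nlinarith [sq_nonneg (damp κ x), mul_nonneg (sq_nonneg (damp κ x)) h5]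

lemma tendsto_damp {κ : ℕ → ℝ} (hκ : Tendsto κ atTop (𝓝 0)) (x : Phase d) :
    Tendsto (fun n => damp (κ n) x) atTop (𝓝 1) := by
  have h : Tendsto (fun n => 1 + κ n * halfSq x) atTop (𝓝 (1 + 0 * halfSq x)) :=
    (hκ.mul_const _).const_add 1
  simpa [damp] using h.inv₀ (by simp)

end Damping

section SmoothCase

variable {d : ℕ}

/-- Fatou's lemma for nonnegative functions with bounded integrals. -/
lemma integrable_of_tendsto_of_integral_le {α : Type*} [MeasurableSpace α] {μ : Measure α}
    {G : ℕ → α → ℝ} {g : α → ℝ} {c : ℝ} (hG : ∀ n, Integrable (G n) μ) (hG0 : ∀ n x, 0 ≤ G n x)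
    (hGc : ∀ n, ∫ x, G n x ∂μ ≤ c) (h : ∀ x, Tendsto (fun n => G n x) atTop (𝓝 (g x))) :
    Integrable g μ := by
  refine ⟨aestronglyMeasurable_of_tendsto_ae atTop (fun n => (hG n).1) (Eventually.of_forall h), ?_⟩
  have h1 : ∫⁻ x, ‖g x‖ₑ ∂μ ≤ liminf (fun n => ∫⁻ x, ‖G n x‖ₑ ∂μ) atTop := by
    calc ∫⁻ x, ‖g x‖ₑ ∂μ = ∫⁻ x, liminf (fun n => ‖G n x‖ₑ) atTop ∂μ :=
          lintegral_congr fun x => ((h x).enorm.liminf_eq).symm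
      _ ≤ _ := lintegral_liminf_le' fun n => (hG n).1.aemeasurable.enorm
  have h2 : liminf (fun n => ∫⁻ x, ‖G n x‖ₑ ∂μ) atTop ≤ ENNReal.ofReal c := by
    refine (liminf_le_liminf (Eventually.of_forall fun n => ?_)).trans_eq (liminf_const _)
    rw [← ofReal_integral_norm_eq_lintegral_enorm (hG n)]
    refine ENNReal.ofReal_le_ofReal (le_of_eq_of_le ?_ (hGc n))
    exact integral_congr_ae (Eventually.of_forall fun x => by
      simp [abs_of_nonneg (hG0 n x)])
  exact (h1.trans h2).trans_lt ENNReal.ofReal_lt_top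

lemma Integrable.mul_of_bound {f g : Phase d → ℝ} (hf : Integrable f) (hg : Continuous g)
    {C : ℝ} (hC : ∀ x, |g x| ≤ C) : Integrable (fun x => f x * g x) :=
  hf.mul_bdd (c := C) hg.aestronglyMeasurable (Eventually.of_forall hC)

lemma SmoothDensity.integrable_mul_sq {m c : ℝ} (hm : 0 < m) {f : Phase d → ℝ}
    (hf : SmoothDensity f) (hc : ∀ φ, IsTestFn φ → 2 * ∫ x, f x * fisherIntegrand m φ x ≤ c)
    (i : Fin d) : Integrable (fun x => f x * x.2 i ^ 2) := by
  have hf0 : 0 ≤ ∫ x, f x := integral_nonneg hf.nonneg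
  have main : ∀ κ : ℝ, 0 < κ → ∑ i, ∫ x, f x * (damp κ x ^ 2 * x.2 i ^ 2)
      ≤ m ^ 2 * (c + ∑ _i : Fin d, 10 / m * ∫ x, f x) ∧
      ∀ i, Integrable (fun x => f x * (damp κ x ^ 2 * x.2 i ^ 2)) := by
    intro κ hκ
    have cd := (contDiff_damp (d := d) hκ).continuous
    have cs : ∀ i : Fin d, Continuous fun x : Phase d => x.2 i := fun i =>
      (contDiff_snd_apply i).continuous
    have hint : ∀ i, Integrable (fun x => f x * (damp κ x ^ 2 * x.2 i ^ 2)) := fun i =>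
      Integrable.mul_of_bound hf.integrable (by fun_prop) (fun x => by
        rw [abs_of_nonneg (by positivity)]
        exact damp_sq_mul_sq_le hκ x i)
    refine ⟨?_, hint⟩
    have hgrad : ∀ x i, pdP (fun y : Phase d => (-(1 / m)) * dampPot κ y) x i
        = -((damp κ x ^ 2 * x.2 i) / m) := fun x i => by
      rw [pdP_const_mul, pdP_dampPot hκ]; ring
    have hbd : ∀ (x : Phase d) i, |damp κ x ^ 2 * x.2 i / m| ≤ (1 + 2 * κ⁻¹) / m := fun x i => by
      rw [abs_div, abs_of_pos hm]
      exact div_le_div_of_nonneg_right (abs_damp_sq_mul_le hκ x i) hm.le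
    have h := hf.sum_fieldTerm_grad_le hc (φ := fun y => (-(1 / m)) * dampPot κ y)
      (contDiff_const.mul (contDiff_dampPot hκ)) (B := (1 + 2 * κ⁻¹) / m)
      (fun x => by
        rw [abs_mul, abs_neg, abs_of_pos (by positivity : 0 < 1 / m), one_div, inv_mul_eq_div]
        refine div_le_div_of_nonneg_right ((abs_dampPot_le hκ x).trans ?_) hm.le
        have := inv_pos.2 hκ
        linarith)
      (fun x i => by rw [hgrad, abs_neg]; exact hbd x i)
      (fun i => by
        have := (hint i).const_mul (-(1 / m))
        refine this.congr (Eventually.of_forall fun x => ?_)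
        simp only [hgrad]
        ring)
    have hterm : ∀ i, (1 / m ^ 2) * ∫ x, f x * (damp κ x ^ 2 * x.2 i ^ 2)
        ≤ fieldTerm m f i (fun x => - pdP (fun y => (-(1 / m)) * dampPot κ y) x i)
          + 10 / m * ∫ x, f x := by
      intro i
      have j1 : Integrable (fun x => pdP f x i * (damp κ x ^ 2 * x.2 i)) :=
        Integrable.mul_of_bound (hf.integrable_pdP i) (by fun_prop) (abs_damp_sq_mul_le hκ · i)
      have j2 : Integrable (fun x => f x * pdP (fun y => damp κ y ^ 2 * y.2 i) x i) :=
        Integrable.mul_of_bound hf.integrable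
          (ContDiff.pdP (contDiff_damp_sq_mul hκ i) i).continuous (abs_pdP_damp_sq_mul_le hκ · i)
      have j3 : Integrable (fun x => f x * (damp κ x ^ 2 * x.2 i)) :=
        Integrable.mul_of_bound hf.integrable (by fun_prop) (abs_damp_sq_mul_le hκ · i)
      have j4 : Integrable (fun x => f x * ((damp κ x ^ 2 * x.2 i) / m) ^ 2) :=
        Integrable.mul_of_bound hf.integrable (C := ((1 + 2 * κ⁻¹) / m) ^ 2) (by fun_prop)
          (fun x => by rw [abs_pow]; exact pow_le_pow_left₀ (abs_nonneg _) (hbd x i) 2)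
      have ibp := integral_mul_pdP i (hf.contDiff.differentiable (by simp))
        ((contDiff_damp_sq_mul hκ i).differentiable (by simp)) j1 j2 j3
      have b : ∫ x, f x * pdP (fun y => damp κ y ^ 2 * y.2 i) x i ≤ 5 * ∫ x, f x := by
        rw [← integral_const_mul]
        refine integral_mono j2 (hf.integrable.const_mul _) fun x => ?_
        have := (abs_le.1 (abs_pdP_damp_sq_mul_le hκ x i)).2
        simp only []
        nlinarith [hf.nonneg x]
      have j5 : Integrable (fun x => (2 / m ^ 2) * (f x * (damp κ x ^ 2 * x.2 i ^ 2))
          - f x * ((damp κ x ^ 2 * x.2 i) / m) ^ 2) := ((hint i).const_mul _).sub j4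
      have e : fieldTerm m f i (fun x => - pdP (fun y => (-(1 / m)) * dampPot κ y) x i)
          = (2 / m) * (∫ x, pdP f x i * (damp κ x ^ 2 * x.2 i))
            + ((2 / m ^ 2) * (∫ x, f x * (damp κ x ^ 2 * x.2 i ^ 2))
            - ∫ x, f x * ((damp κ x ^ 2 * x.2 i) / m) ^ 2) := by
        rw [← integral_const_mul, ← integral_const_mul,
          ← integral_sub ((hint i).const_mul _) j4,
          ← integral_add (j1.const_mul _) j5]
        unfold fieldTerm
        congr 1
        ext x
        simp only [hgrad]
        field_simp
        ring
      have s : ∫ x, f x * ((damp κ x ^ 2 * x.2 i) / m) ^ 2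
          ≤ (1 / m ^ 2) * ∫ x, f x * (damp κ x ^ 2 * x.2 i ^ 2) := by
        rw [← integral_const_mul]
        refine integral_mono j4 ((hint i).const_mul _) fun x => ?_
        have h1 : damp κ x ^ 2 ≤ 1 := pow_le_one₀ (damp_pos hκ x).le (damp_le_one hκ x)
        have h2 := mul_nonneg (hf.nonneg x) (mul_nonneg (sq_nonneg (damp κ x)) (sq_nonneg (x.2 i)))
        have h3 : f x * ((damp κ x ^ 2 * x.2 i) / m) ^ 2
          = (1 / m ^ 2) * (damp κ x ^ 2 * (f x * (damp κ x ^ 2 * x.2 i ^ 2))) := by ring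
        simp only []
        rw [h3]
        exact mul_le_mul_of_nonneg_left (mul_le_of_le_one_left h2 h1) (by positivity)
      have b' := mul_le_mul_of_nonneg_left b (by positivity : (0 : ℝ) ≤ 2 / m)
      have ibp2 : (2 / m) * (∫ x, pdP f x i * (damp κ x ^ 2 * x.2 i))
          = - (2 / m * ∫ x, f x * pdP (fun y => damp κ y ^ 2 * y.2 i) x i) := by
        rw [ibp]; ring
      have e2 : (2 / m ^ 2) = 1 / m ^ 2 + 1 / m ^ 2 := by ring
      have e3 : 10 / m * ∫ x, f x = 2 / m * (5 * ∫ x, f x) := by ring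
      rw [e, e2, e3, add_mul, ibp2]
      linarith
    have := (Finset.sum_le_sum fun i (_ : i ∈ Finset.univ) => hterm i).trans_eq
      Finset.sum_add_distrib
    rw [← Finset.mul_sum, one_div, inv_mul_eq_div, div_le_iff₀ (by positivity)] at this
    refine this.trans ?_
    rw [mul_comm]
    exact mul_le_mul_of_nonneg_left (by linarith) (by positivity)
  have hκn : ∀ n : ℕ, (0 : ℝ) < 1 / ((n : ℝ) + 1) := fun n => by positivity
  refine integrable_of_tendsto_of_integral_le
    (G := fun n x => f x * (damp (1 / ((n : ℝ) + 1)) x ^ 2 * x.2 i ^ 2))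
    (c := m ^ 2 * (c + ∑ _i : Fin d, 10 / m * ∫ x, f x))
    (fun n => (main _ (hκn n)).2 i) (fun n x => ?_) (fun n => ?_) (fun x => ?_)
  · exact mul_nonneg (hf.nonneg x) (by positivity)
  · refine le_trans ?_ (main _ (hκn n)).1
    exact Finset.single_le_sum (f := fun i => ∫ x, f x * (damp (1 / ((n : ℝ) + 1)) x ^ 2 * x.2 i ^ 2))
      (fun i _ => integral_nonneg fun x => mul_nonneg (hf.nonneg x) (by positivity))
      (Finset.mem_univ i)
  · have := (tendsto_damp tendsto_one_div_add_atTop_nhds_zero_nat x).pow 2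
    simpa using (this.mul_const (x.2 i ^ 2)).const_mul (f x)

end SmoothCase

section SmoothField

variable {d : ℕ}

/-- The truncated mass `δ log (1 + t / δ)`, which increases to `t` as `δ → ∞` and vanishes
as `δ → 0`. -/
def logMass (δ t : ℝ) : ℝ := δ * Real.log (1 + t / δ)

lemma logMass_nonneg {δ t : ℝ} (hδ : 0 < δ) (ht : 0 ≤ t) : 0 ≤ logMass δ t :=
  mul_nonneg hδ.le (Real.log_nonneg (by have := div_nonneg ht hδ.le; linarith))

lemma logMass_le {δ t : ℝ} (hδ : 0 < δ) (ht : 0 ≤ t) : logMass δ t ≤ t := by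
  have h := Real.log_le_sub_one_of_pos (x := 1 + t / δ) (by positivity)
  calc logMass δ t ≤ δ * (t / δ) := mul_le_mul_of_nonneg_left (by linarith) hδ.le
    _ = t := by field_simp

lemma logMass_le_sqrt {δ t : ℝ} (hδ : 0 < δ) (ht : 0 ≤ t) : logMass δ t ≤ 2 * √(t * δ) := by
  have hs : 0 ≤ t / δ := by positivity
  have h : Real.log (1 + t / δ) ≤ 2 * √(t / δ) := by
    rw [Real.log_le_iff_le_exp (by positivity), two_mul, Real.exp_add]
    have h1 := Real.add_one_le_exp √(t / δ)
    have h2 := Real.sqrt_nonneg (t / δ)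
    nlinarith [Real.sq_sqrt hs]
  calc logMass δ t ≤ δ * (2 * √(t / δ)) := mul_le_mul_of_nonneg_left h hδ.le
    _ = 2 * √(t * δ) := by
      have : t * δ = (t / δ) * δ ^ 2 := by field_simp
      rw [this, Real.sqrt_mul hs, Real.sqrt_sq hδ.le]; ring

lemma hasDerivAt_logMass {δ t : ℝ} (hδ : 0 < δ) (ht : 0 ≤ t) :
    HasDerivAt (logMass δ) (δ / (t + δ)) t := by
  have h : (1 : ℝ) + t / δ ≠ 0 := by positivity
  have := ((((hasDerivAt_id t).div_const δ).const_add 1).log h).const_mul δ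
  have e : δ * (1 / δ / (1 + id t / δ)) = δ / (t + δ) := by
    have : t + δ ≠ 0 := by positivity
    simp only [id]
    field_simp
    ring
  rw [e] at this
  exact this

lemma SmoothDensity.contDiff_logMass {f : Phase d → ℝ} (hf : SmoothDensity f) {δ : ℝ}
    (hδ : 0 < δ) : ContDiff ℝ (⊤ : ℕ∞) (fun x => logMass δ (f x)) := by
  refine contDiff_const.mul (ContDiff.log (contDiff_const.add (hf.contDiff.div_const δ)) fun x => ?_)
  have := hf.nonneg x
  positivity

lemma SmoothDensity.pdP_logMass {f : Phase d → ℝ} (hf : SmoothDensity f) {δ : ℝ}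
    (hδ : 0 < δ) (x : Phase d) (i : Fin d) :
    pdP (fun y => logMass δ (f y)) x i = δ * (pdP f x i / (f x + δ)) := by
  rw [pdP_comp (hasDerivAt_logMass hδ (hf.nonneg x)) (hf.contDiff.differentiable (by simp) x)]
  ring

/-- The regularized score `∂_{p_i} f / (f + δ) + (1 + δ|p|²/2)⁻² p_i / m`. -/
def score (m δ : ℝ) (f : Phase d → ℝ) (i : Fin d) (x : Phase d) : ℝ :=
  pdP f x i / (f x + δ) + damp δ x ^ 2 * x.2 i / m

lemma SmoothDensity.continuous_score {f : Phase d → ℝ} (hf : SmoothDensity f) {δ : ℝ}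
    (hδ : 0 < δ) (m : ℝ) (i : Fin d) : Continuous (score m δ f i) := by
  have h1 := (ContDiff.pdP hf.contDiff i).continuous
  have h2 := hf.contDiff.continuous
  have h3 := (contDiff_damp_sq_mul (d := d) hδ i).continuous
  exact (h1.div (h2.add continuous_const) fun x =>
    (add_pos_of_nonneg_of_pos (hf.nonneg x) hδ).ne').add (h3.div_const m)

lemma SmoothDensity.exists_bound_score {f : Phase d → ℝ} (hf : SmoothDensity f) {δ : ℝ}
    (hδ : 0 < δ) {m : ℝ} (hm : 0 < m) : ∃ B, ∀ x i, |score m δ f i x| ≤ B := by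
  obtain ⟨M, hM⟩ := hf.bounded_pdP
  refine ⟨M / δ + (1 + 2 * δ⁻¹) / m, fun x i => (abs_add_le _ _).trans (add_le_add ?_ ?_)⟩
  · have := hf.nonneg x
    rw [abs_div, abs_of_pos (add_pos_of_nonneg_of_pos this hδ)]
    exact div_le_div₀ ((abs_nonneg _).trans (hM x i)) (hM x i) hδ (by linarith)
  · rw [abs_div, abs_of_pos hm]
    exact div_le_div_of_nonneg_right (abs_damp_sq_mul_le hδ x i) hm.le

lemma SmoothDensity.integrable_mul_snd {f : Phase d → ℝ} (hf : SmoothDensity f) {i : Fin d}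
    (h : Integrable (fun x => f x * x.2 i ^ 2)) : Integrable (fun x => f x * x.2 i) := by
  refine (hf.integrable.add h).mono
    (hf.contDiff.continuous.mul (contDiff_snd_apply i).continuous).aestronglyMeasurable
    (Eventually.of_forall fun x => ?_)
  have h0 := hf.nonneg x
  rw [Real.norm_eq_abs, Real.norm_eq_abs, abs_mul, abs_of_nonneg h0]
  refine le_trans ?_ (le_abs_self _)
  simp only [Pi.add_apply]
  have : |x.2 i| ≤ 1 + x.2 i ^ 2 := by
    rw [abs_le]; constructor <;> nlinarith [sq_nonneg (x.2 i - 1), sq_nonneg (x.2 i + 1)]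
  nlinarith

lemma SmoothDensity.sum_fieldTerm_score_le {m c : ℝ} (hm : 0 < m) {f : Phase d → ℝ}
    (hf : SmoothDensity f) (hc : ∀ φ, IsTestFn φ → 2 * ∫ x, f x * fisherIntegrand m φ x ≤ c)
    {δ : ℝ} (hδ : 0 < δ) : ∑ i, fieldTerm m f i (score m δ f i) ≤ c := by
  obtain ⟨B, hB⟩ := hf.exists_bound_score hδ hm
  obtain ⟨M, hM⟩ := hf.bounded
  have hd := (hf.contDiff_logMass hδ)
  have hgrad : ∀ x i, pdP (fun y : Phase d => (-δ⁻¹) * logMass δ (f y) + (-(1 / m)) * dampPot δ y)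
      x i = - score m δ f i x := fun x i => by
    rw [pdP_add ((contDiff_const.mul hd).differentiable (by simp) x)
      ((contDiff_const.mul (contDiff_dampPot hδ)).differentiable (by simp) x), pdP_const_mul,
      pdP_const_mul, pdP_dampPot hδ, hf.pdP_logMass hδ, score]
    field_simp
    ring
  have h := hf.sum_fieldTerm_grad_le hc
    (φ := fun y => (-δ⁻¹) * logMass δ (f y) + (-(1 / m)) * dampPot δ y)
    ((contDiff_const.mul hd).add (contDiff_const.mul (contDiff_dampPot hδ)))
    (B := max B (δ⁻¹ * M + 1 / m * δ⁻¹))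
    (fun x => by
      refine ((abs_add_le _ _).trans (add_le_add ?_ ?_)).trans (le_max_right _ _)
      · rw [abs_mul, abs_neg, abs_of_pos (inv_pos.2 hδ), abs_of_nonneg (logMass_nonneg hδ (hf.nonneg x))]
        exact mul_le_mul_of_nonneg_left ((logMass_le hδ (hf.nonneg x)).trans (hM x)) (by positivity)
      · rw [abs_mul, abs_neg, abs_of_pos (by positivity : 0 < 1 / m)]
        exact mul_le_mul_of_nonneg_left (abs_dampPot_le hδ x) (by positivity))
    (fun x i => by rw [hgrad, abs_neg]; exact (hB x i).trans (le_max_left _ _))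
    (fun i => by
      refine ((Integrable.mul_of_bound (hf.integrable_mul_snd (hf.integrable_mul_sq hm hc i))
        (hf.continuous_score hδ m i) (hB · i)).const_mul (-1)).congr
        (Eventually.of_forall fun x => ?_)
      simp only [hgrad]
      ring)
  simpa only [hgrad, neg_neg] using h

lemma SmoothDensity.integrable_logMass {f : Phase d → ℝ} (hf : SmoothDensity f) {δ : ℝ}
    (hδ : 0 < δ) : Integrable (fun x => logMass δ (f x)) :=
  hf.integrable.mono (hf.contDiff_logMass hδ).continuous.aestronglyMeasurable
    (Eventually.of_forall fun x => by
      rw [Real.norm_eq_abs, Real.norm_eq_abs, abs_of_nonneg (logMass_nonneg hδ (hf.nonneg x)),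
        abs_of_nonneg (hf.nonneg x)]
      exact logMass_le hδ (hf.nonneg x))

lemma integrable_damp_remainder {f : Phase d → ℝ} {i : Fin d}
    (h : Integrable (fun x => f x * x.2 i ^ 2)) {δ : ℝ} (hδ : 0 < δ) :
    Integrable (fun x => f x * x.2 i ^ 2 * (1 - damp δ x ^ 2) ^ 2) := by
  have := (contDiff_damp (d := d) hδ).continuous
  refine Integrable.mul_of_bound h (C := 1) (by fun_prop) fun x => ?_
  have h0 := (damp_pos hδ x).le
  have h1 : damp δ x ^ 2 ≤ 1 := pow_le_one₀ h0 (damp_le_one hδ x)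
  rw [abs_of_nonneg (sq_nonneg _)]
  exact pow_le_one₀ (by linarith) (by nlinarith)

lemma SmoothDensity.fieldTerm_le_score {m : ℝ} (hm : 0 < m) {f : Phase d → ℝ}
    (hf : SmoothDensity f) {i : Fin d} (h2 : Integrable (fun x => f x * x.2 i ^ 2))
    {δ : ℝ} (hδ : 0 < δ) {ψ : Phase d → ℝ} (hψ : IsTestFn ψ) :
    fieldTerm m f i ψ ≤ fieldTerm m f i (score m δ f i)
      + (1 / m ^ 2 * (∫ x, f x * x.2 i ^ 2 * (1 - damp δ x ^ 2) ^ 2)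
        + δ / 2 * (∫ x, ψ x ^ 2) + 10 / m * ∫ x, logMass δ (f x)) := by
  obtain ⟨B, hB⟩ := hf.exists_bound_score hδ hm
  have h1 := hf.integrable_mul_snd h2
  have cs : Continuous fun x : Phase d => x.2 i := (contDiff_snd_apply i).continuous
  have cf := hf.contDiff.continuous
  have cg := (ContDiff.pdP hf.contDiff i).continuous
  have cS := hf.continuous_score hδ m i
  have jS : Integrable (fun x => 2 * (pdP f x i + f x * (x.2 i / m)) * score m δ f i x
      - f x * score m δ f i x ^ 2) := by
    have e1 := Integrable.mul_of_bound (hf.integrable_pdP i) cS (hB · i)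
    have e2 := Integrable.mul_of_bound h1 cS (hB · i)
    have e3 := Integrable.mul_of_bound hf.integrable
      (g := fun x => score m δ f i x ^ 2) (by fun_prop) (C := B ^ 2) (fun x => by
      rw [abs_pow]; exact pow_le_pow_left₀ (abs_nonneg _) (hB x i) 2)
    refine (((e1.const_mul 2).add (e2.const_mul (2 / m))).sub e3).congr
      (Eventually.of_forall fun x => ?_)
    simp only [Pi.add_apply, Pi.sub_apply]
    ring
  have jψ : Integrable (fun x => 2 * (pdP f x i + f x * (x.2 i / m)) * ψ x - f x * ψ x ^ 2) := by
    have cψ := hψ.1.continuous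
    refine Continuous.integrable_of_hasCompactSupport (by fun_prop) (hψ.2.mono' ?_)
    refine subset_trans (fun x hx => ?_) subset_closure
    contrapose! hx
    simp only [Function.mem_support, not_not] at hx ⊢
    simp [hx]
  have jq : Integrable (fun x => ψ x ^ 2) := by
    have cψ := hψ.1.continuous
    simp only [sq]
    exact (cψ.mul cψ).integrable_of_hasCompactSupport hψ.2.mul_right
  have jL := hf.integrable_logMass hδ
  have jR := integrable_damp_remainder h2 hδ
  have jL' : Integrable (fun x => pdP (fun y => logMass δ (f y)) x i) := by
    refine (hf.integrable_pdP i).mono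
      (ContDiff.pdP (hf.contDiff_logMass hδ) i).continuous.aestronglyMeasurable
      (Eventually.of_forall fun x => ?_)
    have h0 := hf.nonneg x
    have hp : 0 < f x + δ := by positivity
    rw [hf.pdP_logMass hδ, Real.norm_eq_abs, Real.norm_eq_abs, abs_mul, abs_div, abs_of_pos hδ,
      abs_of_pos hp, mul_div_assoc', div_le_iff₀ hp, mul_comm]
    exact mul_le_mul_of_nonneg_left (by linarith) (abs_nonneg _)
  have jL1 : Integrable (fun x => pdP (fun y => logMass δ (f y)) x i * (damp δ x ^ 2 * x.2 i)) :=
    Integrable.mul_of_bound jL' (contDiff_damp_sq_mul hδ i).continuous (abs_damp_sq_mul_le hδ · i)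
  have jL2 : Integrable (fun x => logMass δ (f x) * pdP (fun y => damp δ y ^ 2 * y.2 i) x i) :=
    Integrable.mul_of_bound jL (ContDiff.pdP (contDiff_damp_sq_mul hδ i) i).continuous
      (abs_pdP_damp_sq_mul_le hδ · i)
  have ibp := integral_mul_pdP i ((hf.contDiff_logMass hδ).differentiable (by simp))
    ((contDiff_damp_sq_mul hδ i).differentiable (by simp)) jL1 jL2
    (Integrable.mul_of_bound jL (contDiff_damp_sq_mul hδ i).continuous (abs_damp_sq_mul_le hδ · i))
  have b : ∫ x, logMass δ (f x) * pdP (fun y => damp δ y ^ 2 * y.2 i) x i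
      ≤ 5 * ∫ x, logMass δ (f x) := by
    rw [← integral_const_mul]
    refine integral_mono jL2 (jL.const_mul _) fun x => ?_
    have := (abs_le.1 (abs_pdP_damp_sq_mul_le hδ x i)).2
    have := logMass_nonneg hδ (hf.nonneg x)
    simp only []
    nlinarith
  have key : fieldTerm m f i ψ ≤ ∫ x, ((2 * (pdP f x i + f x * (x.2 i / m)) * score m δ f i x
      - f x * score m δ f i x ^ 2) + (1 / m ^ 2 * (f x * x.2 i ^ 2 * (1 - damp δ x ^ 2) ^ 2)
        + δ / 2 * ψ x ^ 2 +
        -(2 / m) * (pdP (fun y => logMass δ (f y)) x i * (damp δ x ^ 2 * x.2 i)))) := by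
    refine integral_mono jψ (jS.add (((jR.const_mul _).add (jq.const_mul _)).add
      (jL1.const_mul _))) fun x => ?_
    have h0 := hf.nonneg x
    have hp : 0 < f x + δ := by positivity
    simp only []
    rw [hf.pdP_logMass hδ]
    unfold score
    set V := pdP f x i / (f x + δ) with hV
    have hg : pdP f x i = (f x + δ) * V := by rw [hV]; field_simp
    rw [hg]
    set a := damp δ x ^ 2
    obtain ⟨P, hP⟩ : ∃ P, x.2 i = m * P := ⟨x.2 i / m, by field_simp⟩
    rw [hP]
    have e1 : m * P / m = P := by field_simp
    have e2 : a * (m * P) / m = a * P := by field_simp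
    have e3 : 1 / m ^ 2 * (f x * (m * P) ^ 2 * (1 - a) ^ 2) = f x * ((1 - a) * P) ^ 2 := by
      field_simp
    have e4 : -(2 / m) * (δ * V * (a * (m * P))) = - 2 * (δ * V * (a * P)) := by field_simp
    rw [e1, e2, e3, e4]
    have q1 := mul_nonneg h0 (sq_nonneg (ψ x - (V + a * P) - (1 - a) * P))
    have q2 := mul_nonneg hδ.le (sq_nonneg (ψ x - 2 * V))
    nlinarith
  refine key.trans ?_
  have jt1 : Integrable (fun x => 1 / m ^ 2 * (f x * x.2 i ^ 2 * (1 - damp δ x ^ 2) ^ 2)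
        + δ / 2 * ψ x ^ 2) := (jR.const_mul _).add (jq.const_mul _)
  have jt2 : Integrable (fun x => 1 / m ^ 2 * (f x * x.2 i ^ 2 * (1 - damp δ x ^ 2) ^ 2)
        + δ / 2 * ψ x ^ 2 +
        -(2 / m) * (pdP (fun y => logMass δ (f y)) x i * (damp δ x ^ 2 * x.2 i))) :=
    jt1.add (jL1.const_mul _)
  rw [integral_add jS jt2, integral_add jt1 (jL1.const_mul _),
    integral_add (jR.const_mul _) (jq.const_mul _), integral_const_mul, integral_const_mul,
    integral_const_mul]
  have b' := mul_le_mul_of_nonneg_left b (by positivity : (0 : ℝ) ≤ 2 / m)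
  have ibp2 : -(2 / m) * (∫ x, pdP (fun y => logMass δ (f y)) x i * (damp δ x ^ 2 * x.2 i))
      = 2 / m * ∫ x, logMass δ (f x) * pdP (fun y => damp δ y ^ 2 * y.2 i) x i := by
    rw [ibp]; ring
  have e3 : 10 / m * ∫ x, logMass δ (f x) = 2 / m * (5 * ∫ x, logMass δ (f x)) := by ring
  rw [ibp2, e3]
  unfold fieldTerm
  linarith

lemma SmoothDensity.sum_fieldTerm_le {m c : ℝ} (hm : 0 < m) {f : Phase d → ℝ}
    (hf : SmoothDensity f) (hc : ∀ φ, IsTestFn φ → 2 * ∫ x, f x * fisherIntegrand m φ x ≤ c)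
    {ψ : Fin d → Phase d → ℝ} (hψ : ∀ i, IsTestFn (ψ i)) :
    ∑ i, fieldTerm m f i (ψ i) ≤ c := by
  have h2 := hf.integrable_mul_sq hm hc
  set δ : ℕ → ℝ := fun n => 1 / ((n : ℝ) + 1) with hδd
  have hδ : ∀ n, 0 < δ n := fun n => by simp only [hδd]; positivity
  have hδ0 : Tendsto δ atTop (𝓝 0) := tendsto_one_div_add_atTop_nhds_zero_nat
  have t1 : ∀ i, Tendsto (fun n => ∫ x, f x * x.2 i ^ 2 * (1 - damp (δ n) x ^ 2) ^ 2) atTop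
      (𝓝 0) := fun i => by
    have := tendsto_integral_of_dominated_convergence
      (F := fun n x => f x * x.2 i ^ 2 * (1 - damp (δ n) x ^ 2) ^ 2) (f := fun _ => (0 : ℝ))
      (fun x => f x * x.2 i ^ 2) (fun n => (integrable_damp_remainder (h2 i) (hδ n)).1) (h2 i)
      (fun n => Eventually.of_forall fun x => by
        have h0 := (damp_pos (hδ n) x).le
        have h1 : damp (δ n) x ^ 2 ≤ 1 := pow_le_one₀ h0 (damp_le_one (hδ n) x)
        have hp := mul_nonneg (hf.nonneg x) (sq_nonneg (x.2 i))
        rw [Real.norm_eq_abs, abs_of_nonneg (mul_nonneg hp (sq_nonneg _))]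
        exact mul_le_of_le_one_right hp (pow_le_one₀ (by linarith) (by nlinarith)))
      (Eventually.of_forall fun x => by
        have := ((((tendsto_damp hδ0 x).pow 2).const_sub 1).pow 2).const_mul (f x * x.2 i ^ 2)
        simpa using this)
    simpa using this
  have t2 : Tendsto (fun n => ∫ x, logMass (δ n) (f x)) atTop (𝓝 0) := by
    have := tendsto_integral_of_dominated_convergence
      (F := fun n x => logMass (δ n) (f x)) (f := fun _ => (0 : ℝ))
      f (fun n => (hf.integrable_logMass (hδ n)).1) hf.integrable
      (fun n => Eventually.of_forall fun x => by
        rw [Real.norm_eq_abs, abs_of_nonneg (logMass_nonneg (hδ n) (hf.nonneg x))]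
        exact logMass_le (hδ n) (hf.nonneg x))
      (Eventually.of_forall fun x => by
        have h3 : Tendsto (fun n => 2 * √(f x * δ n)) atTop (𝓝 0) := by
          simpa using ((hδ0.const_mul (f x)).sqrt).const_mul 2
        exact squeeze_zero (fun n => logMass_nonneg (hδ n) (hf.nonneg x))
          (fun n => logMass_le_sqrt (hδ n) (hf.nonneg x)) h3)
    simpa using this
  have t3 : Tendsto (fun n => c + ∑ i, (1 / m ^ 2 *
      (∫ x, f x * x.2 i ^ 2 * (1 - damp (δ n) x ^ 2) ^ 2)
        + δ n / 2 * (∫ x, ψ i x ^ 2) + 10 / m * ∫ x, logMass (δ n) (f x))) atTop (𝓝 c) := by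
    have : Tendsto (fun n => ∑ i, (1 / m ^ 2 *
      (∫ x, f x * x.2 i ^ 2 * (1 - damp (δ n) x ^ 2) ^ 2)
        + δ n / 2 * (∫ x, ψ i x ^ 2) + 10 / m * ∫ x, logMass (δ n) (f x))) atTop
        (𝓝 (∑ i, (1 / m ^ 2 * 0 + 0 / 2 * (∫ x, ψ i x ^ 2) + 10 / m * 0))) :=
      tendsto_finsetSum _ fun i _ => (((t1 i).const_mul _).add
        ((hδ0.div_const 2).mul_const _)).add (t2.const_mul _)
    simpa using this.const_add c
  refine ge_of_tendsto t3 (Eventually.of_forall fun n => ?_)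
  refine (Finset.sum_le_sum fun i _ => hf.fieldTerm_le_score hm (h2 i) (hδ n) (hψ i)).trans ?_
  rw [Finset.sum_add_distrib]
  exact add_le_add_left (hf.sum_fieldTerm_score_le hm hc (hδ n)) _

end SmoothField

section Mollification

variable {d : ℕ}

instance : (volume : Measure (Phase d)).IsNegInvariant :=
  Measure.IsAddHaarMeasure.isNegInvariant_of_innerRegular _

/-- Convolution of real functions on phase space. -/
def conv (ρ f : Phase d → ℝ) : Phase d → ℝ :=
  convolution ρ f (ContinuousLinearMap.lsmul ℝ ℝ) volume

lemma conv_apply (ρ f : Phase d → ℝ) (x : Phase d) : conv ρ f x = ∫ t, ρ t * f (x - t) := rfl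

lemma IsTestFn.integrable {φ : Phase d → ℝ} (h : IsTestFn φ) : Integrable φ :=
  h.1.continuous.integrable_of_hasCompactSupport h.2

lemma IsTestFn.contDiff_conv {ρ f : Phase d → ℝ} (hρ : IsTestFn ρ)
    (hf : LocallyIntegrable f volume) : ContDiff ℝ (⊤ : ℕ∞) (conv ρ f) :=
  hρ.2.contDiff_convolution_left _ hρ.1 hf

lemma IsTestFn.pdP_conv {ρ f : Phase d → ℝ} (hρ : IsTestFn ρ)
    (hf : LocallyIntegrable f volume) (x : Phase d) (i : Fin d) :
    _root_.pdP (conv ρ f) x i = conv (fun t => _root_.pdP ρ t i) f x := by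
  have h := hρ.2.hasFDerivAt_convolution_left (ContinuousLinearMap.lsmul ℝ ℝ)
    (hρ.1.of_le (by simp)) hf x
  have hint := (hρ.2.fderiv (𝕜 := ℝ)).convolutionExists_left
    ((ContinuousLinearMap.lsmul ℝ ℝ : ℝ →L[ℝ] ℝ →L[ℝ] ℝ).precompL (Phase d))
    (hρ.1.continuous_fderiv (by simp)) hf x
  unfold _root_.pdP conv
  rw [h.fderiv, convolution_def, ContinuousLinearMap.integral_apply hint]
  rfl

lemma abs_conv_le {ρ f : Phase d → ℝ} {C : ℝ} (hC : ∀ x, |ρ x| ≤ C) (hf : Integrable f)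
    (x : Phase d) : |conv ρ f x| ≤ C * ∫ y, |f y| := by
  rw [conv_apply, ← integral_sub_left_eq_self (fun y => |f y|) volume x, ← integral_const_mul]
  rw [← Real.norm_eq_abs]
  refine norm_integral_le_of_norm_le ((hf.abs.comp_sub_left x).const_mul C)
    (Eventually.of_forall fun t => ?_)
  rw [Real.norm_eq_abs, abs_mul]
  exact mul_le_mul_of_nonneg_right (hC t) (abs_nonneg _)

lemma integrable_conv {ρ f : Phase d → ℝ} (hρ : Integrable ρ) (hf : Integrable f) :
    Integrable (conv ρ f) := hρ.integrable_convolution _ hf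

lemma integral_conv {ρ f : Phase d → ℝ} (hρ : Integrable ρ) (hf : Integrable f) :
    ∫ x, conv ρ f x = (∫ x, ρ x) * ∫ x, f x :=
  integral_convolution (E := ℝ) (E' := ℝ) (F := ℝ) (ContinuousLinearMap.lsmul ℝ ℝ) hρ hf

lemma conv_nonneg {ρ f : Phase d → ℝ} (hρ : ∀ x, 0 ≤ ρ x) (hf : ∀ x, 0 ≤ f x) (x : Phase d) :
    0 ≤ conv ρ f x :=
  integral_nonneg fun t => mul_nonneg (hρ t) (hf _)

lemma IsTestFn.smoothDensity_conv {ρ f : Phase d → ℝ} (hρ : IsTestFn ρ) (hρ0 : ∀ x, 0 ≤ ρ x)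
    (hf : Integrable f) (hf0 : ∀ x, 0 ≤ f x) : SmoothDensity (conv ρ f) where
  contDiff := hρ.contDiff_conv hf.locallyIntegrable
  nonneg := conv_nonneg hρ0 hf0
  integrable := integrable_conv hρ.integrable hf
  bounded := by
    obtain ⟨C, -, hC⟩ := hρ.exists_bound
    exact ⟨_, fun x => (le_abs_self _).trans (abs_conv_le hC hf x)⟩
  integrable_pdP i := by
    simp only [hρ.pdP_conv hf.locallyIntegrable]
    exact integrable_conv (hρ.pdP i).integrable hf
  bounded_pdP := by
    choose C hC0 hC using fun i => (hρ.pdP i).exists_bound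
    refine ⟨(∑ i, C i) * ∫ y, |f y|, fun x i => ?_⟩
    rw [hρ.pdP_conv hf.locallyIntegrable]
    refine (abs_conv_le (hC i) hf x).trans (mul_le_mul_of_nonneg_right ?_
      (integral_nonneg fun y => abs_nonneg _))
    exact Finset.single_le_sum (fun i _ => hC0 i) (Finset.mem_univ i)

lemma integral_conv_mul {ρ f k : Phase d → ℝ} (hρ : Integrable ρ) (hf : Integrable f)
    (hk : Continuous k) {C : ℝ} (hC : ∀ x, |k x| ≤ C) :
    Integrable (fun t => ρ t * ∫ x, f x * k (x + t)) ∧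
      ∫ x, conv ρ f x * k x = ∫ t, ρ t * ∫ x, f x * k (x + t) := by
  have h := hρ.convolution_integrand (ContinuousLinearMap.lsmul ℝ ℝ) hf
  have h2 : Integrable (fun p : Phase d × Phase d => (ρ p.2 * f (p.1 - p.2)) * k p.1)
      (volume.prod volume) :=
    Integrable.mul_bdd (c := C) h (hk.comp continuous_fst).aestronglyMeasurable
      (Eventually.of_forall fun p => hC p.1)
  have e : ∀ t, ∫ x, (ρ t * f (x - t)) * k x = ρ t * ∫ x, f x * k (x + t) := fun t => by
    rw [← integral_const_mul, ← integral_add_right_eq_self _ t]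
    simp only [add_sub_cancel_right, mul_assoc]
  have h3 := h2.integral_prod_right
  simp only [e] at h3
  refine ⟨h3, ?_⟩
  rw [← integral_congr_ae (Eventually.of_forall e), ← integral_integral_swap h2]
  refine integral_congr_ae (Eventually.of_forall fun x => ?_)
  simp only [conv_apply]
  rw [integral_mul_const]

lemma fisherIntegrand_const_mul (m a : ℝ) (φ : Phase d → ℝ) (x : Phase d) :
    fisherIntegrand m (fun y => a * φ y) x
      = a * laplP φ x - a * ((1 / m) * ∑ i, x.2 i * pdP φ x i)
        - a ^ 2 * ((1 / 2) * ∑ i, pdP φ x i ^ 2) := by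
  have h : ∀ i, (fun y => pdP (fun z => a * φ z) y i) = fun y => a * pdP φ y i := fun i => by
    ext y; exact pdP_const_mul a i
  have h2 : laplP (fun y => a * φ y) x = a * laplP φ x := by
    unfold laplP
    rw [Finset.mul_sum]
    refine Finset.sum_congr rfl fun i _ => ?_
    rw [h i]
    exact pdP_const_mul (φ := fun y => pdP φ y i) a i
  unfold fisherIntegrand
  rw [h2]
  simp only [pdP_const_mul, mul_pow, Finset.mul_sum]
  congr 1
  · congr 1
    exact Finset.sum_congr rfl fun i _ => by ring
  · exact Finset.sum_congr rfl fun i _ => by ring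

lemma laplP_comp_add_right (φ : Phase d → ℝ) (x y : Phase d) :
    laplP (fun z => φ (z + y)) x = laplP φ (x + y) := by
  unfold laplP
  refine Finset.sum_congr rfl fun i _ => ?_
  simp only [pdP_comp_add_right]
  exact pdP_comp_add_right (fun z => pdP φ z i) x y i

/-- A translate of the Fisher integrand by a vector of size at most `ε` is controlled by the Fisher
integrand of a translated test function. -/
lemma fisherIntegrand_add_le {m ε : ℝ} (hm : 0 < m) (hε : 0 < ε) (hε1 : ε < 1) (φ : Phase d → ℝ)
    (x : Phase d) {t : Phase d} (ht : ∀ i, |t.2 i| ≤ ε) :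
    fisherIntegrand m φ (x + t) ≤
      (1 - ε)⁻¹ * fisherIntegrand m (fun z => (1 - ε) * φ (z + t)) x + d * (ε / (2 * m ^ 2)) := by
  have h1 : (1 - ε) ≠ 0 := by linarith
  rw [fisherIntegrand_const_mul]
  unfold fisherIntegrand
  rw [laplP_comp_add_right]
  simp only [pdP_comp_add_right, Prod.snd_add, Pi.add_apply]
  have e : (1 - ε)⁻¹ * ((1 - ε) * laplP φ (x + t)
      - (1 - ε) * (1 / m * ∑ i, x.2 i * pdP φ (x + t) i)
      - (1 - ε) ^ 2 * (1 / 2 * ∑ i, pdP φ (x + t) i ^ 2))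
      = laplP φ (x + t) - (1 / m * ∑ i, x.2 i * pdP φ (x + t) i)
      - (1 - ε) * (1 / 2 * ∑ i, pdP φ (x + t) i ^ 2) := by
    field_simp
  rw [e]
  have key : ∀ i ∈ Finset.univ, -(1 / m) * (t.2 i * pdP φ (x + t) i)
      ≤ ε * (1 / 2) * pdP φ (x + t) i ^ 2 + ε / (2 * m ^ 2) := fun i _ => by
    set u := pdP φ (x + t) i
    have h2 : t.2 i ^ 2 ≤ ε ^ 2 := sq_le_sq' (by linarith [abs_le.1 (ht i)]) (abs_le.1 (ht i)).2
    have h3 := sq_nonneg (t.2 i / m + ε * u)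
    have h4 : (t.2 i / m) ^ 2 ≤ ε ^ 2 / m ^ 2 := by
      rw [div_pow]; exact div_le_div_of_nonneg_right h2 (by positivity)
    have h5 : ε * (-(1 / m) * (t.2 i * u)) ≤ ε * (ε * (1 / 2) * u ^ 2 + ε / (2 * m ^ 2)) := by
      have e1 : ε * (-(1 / m) * (t.2 i * u)) = - (t.2 i / m) * (ε * u) := by ring
      have e2 : ε * (ε * (1 / 2) * u ^ 2 + ε / (2 * m ^ 2))
        = ((ε * u) ^ 2 + ε ^ 2 / m ^ 2) / 2 := by field_simp
      rw [e1, e2]; nlinarith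
    exact le_of_mul_le_mul_left h5 hε
  have := Finset.sum_le_sum key
  rw [← Finset.mul_sum, Finset.sum_add_distrib, ← Finset.mul_sum, Finset.sum_const,
    Finset.card_univ, Fintype.card_fin, nsmul_eq_mul] at this
  simp only [add_mul, Finset.sum_add_distrib]
  linarith

lemma IsTestFn.fisherIntegrand {φ : Phase d → ℝ} (hφ : IsTestFn φ) (m : ℝ) :
    IsTestFn (_root_.fisherIntegrand m φ) := by
  have hs : ∀ g : Fin d → Phase d → ℝ, (∀ i, IsTestFn (g i)) →
      IsTestFn (fun x => ∑ i, g i x) := fun g hg => by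
    have : (fun x => ∑ i, g i x) = ∑ i, g i := by ext x; simp
    rw [this]
    exact Finset.sum_induction g IsTestFn (fun _ _ => IsTestFn.add) IsTestFn.zero fun i _ => hg i
  have h1 : IsTestFn (laplP φ) := hs _ fun i => (hφ.pdP i).pdP i
  have h2 : IsTestFn (fun x : Phase d => ∑ i, x.2 i * _root_.pdP φ x i) := hs _ fun i => by
    simpa only [mul_comm] using (hφ.pdP i).mul_smooth (contDiff_snd_apply i)
  have h3 : IsTestFn (fun x : Phase d => ∑ i, _root_.pdP φ x i ^ 2) := hs _ fun i => by
    simpa only [sq] using (hφ.pdP i).mul_smooth (ContDiff.pdP hφ.1 i)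
  convert (h1.add (h2.const_mul (-(1 / m)))).add (h3.const_mul (-(1 / 2))) using 1
  ext x
  simp only [_root_.fisherIntegrand, Pi.add_apply]
  ring

lemma fisher_conv_le {m c ε : ℝ} (hm : 0 < m) (hε : 0 < ε) (hε1 : ε < 1) {f ρ : Phase d → ℝ}
    (hf : Integrable f) (hf0 : ∀ x, 0 ≤ f x)
    (hc : ∀ φ, IsTestFn φ → 2 * ∫ x, f x * fisherIntegrand m φ x ≤ c)
    (hρ : Integrable ρ) (hρ0 : ∀ x, 0 ≤ ρ x) (hρ1 : ∫ x, ρ x = 1)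
    (hsupp : ∀ t, ρ t ≠ 0 → ‖t‖ ≤ ε) {φ : Phase d → ℝ} (hφ : IsTestFn φ) :
    2 * ∫ x, conv ρ f x * fisherIntegrand m φ x
      ≤ (1 - ε)⁻¹ * c + d * (ε / m ^ 2) * ∫ x, f x := by
  have hk := hφ.fisherIntegrand m
  obtain ⟨C, -, hC⟩ := hk.exists_bound
  obtain ⟨h1, h2⟩ := integral_conv_mul hρ hf hk.1.continuous hC
  rw [h2, ← integral_const_mul]
  set c' := (1 - ε)⁻¹ * c + d * (ε / m ^ 2) * ∫ x, f x
  have key : ∀ t, ρ t ≠ 0 → 2 * ∫ x, f x * fisherIntegrand m φ (x + t) ≤ c' := fun t ht => by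
    have hφt : IsTestFn (fun z => (1 - ε) * φ (z + t)) := (hφ.comp_add_right t).const_mul _
    have ht' : ∀ i, |t.2 i| ≤ ε := fun i =>
      ((norm_le_pi_norm t.2 i).trans (norm_snd_le t)).trans (hsupp t ht)
    have j1 : Integrable (fun x => f x * fisherIntegrand m (fun z => (1 - ε) * φ (z + t)) x) :=
      (hφt.fisherIntegrand m).integrable_mul hf.locallyIntegrable
    have j2 : Integrable (fun x => f x * fisherIntegrand m φ (x + t)) :=
      (hk.comp_add_right t).integrable_mul hf.locallyIntegrable
    have h3 : ∫ x, f x * fisherIntegrand m φ (x + t)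
        ≤ ∫ x, ((1 - ε)⁻¹ * (f x * fisherIntegrand m (fun z => (1 - ε) * φ (z + t)) x)
          + d * (ε / (2 * m ^ 2)) * f x) := by
      refine integral_mono j2 ((j1.const_mul _).add (hf.const_mul _)) fun x => ?_
      have := mul_le_mul_of_nonneg_left (fisherIntegrand_add_le hm hε hε1 φ x ht') (hf0 x)
      simp only []
      linarith
    rw [integral_add (j1.const_mul _) (hf.const_mul _), integral_const_mul,
      integral_const_mul] at h3
    have h4 := mul_le_mul_of_nonneg_left (hc _ hφt)
      (inv_nonneg.2 (by linarith) : 0 ≤ (1 - ε)⁻¹)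
    have e : d * (ε / m ^ 2) * ∫ x, f x = 2 * (d * (ε / (2 * m ^ 2)) * ∫ x, f x) := by
      field_simp
    simp only [c']
    rw [e]
    linarith
  calc ∫ t, 2 * (ρ t * ∫ x, f x * fisherIntegrand m φ (x + t)) ≤ ∫ t, ρ t * c' := by
        refine integral_mono (h1.const_mul 2) (hρ.mul_const _) fun t => ?_
        by_cases ht : ρ t = 0
        · simp [ht]
        · have := mul_le_mul_of_nonneg_left (key t ht) (hρ0 t)
          simp only []
          linarith
    _ = c' := by rw [integral_mul_const, hρ1, one_mul]

end Mollification

section Mollifier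

variable {d : ℕ}

/-- A smooth approximation of the identity, supported in balls of radius `1 / (n + 2)`. -/
structure IsMollifier (ρ : ℕ → Phase d → ℝ) : Prop where
  isTestFn : ∀ n, IsTestFn (ρ n)
  nonneg : ∀ n x, 0 ≤ ρ n x
  integral_eq_one : ∀ n, ∫ x, ρ n x = 1
  norm_le : ∀ n t, ρ n t ≠ 0 → ‖t‖ ≤ 1 / ((n : ℝ) + 2)
  ae_tendsto : ∀ f, LocallyIntegrable f volume →
    ∀ᵐ x, Tendsto (fun n => conv (ρ n) f x) atTop (𝓝 (f x))

lemma tendsto_one_div_add_two : Tendsto (fun n : ℕ => 1 / ((n : ℝ) + 2)) atTop (𝓝 0) := by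
  have := tendsto_one_div_add_atTop_nhds_zero_nat (𝕜 := ℝ)
  refine squeeze_zero (fun n => by positivity) (fun n => ?_) this
  exact one_div_le_one_div_of_le (by positivity) (by linarith)

lemma exists_isMollifier (d : ℕ) : ∃ ρ : ℕ → Phase d → ℝ, IsMollifier ρ := by
  let b : ℕ → ContDiffBump (0 : Phase d) := fun n =>
    ⟨1 / ((n : ℝ) + 2) / 2, 1 / ((n : ℝ) + 2), by positivity, half_lt_self (by positivity)⟩
  refine ⟨fun n => (b n).normed volume, fun n => ⟨(b n).contDiff_normed,
    (b n).hasCompactSupport_normed⟩, fun n x => (b n).nonneg_normed x,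
    fun n => (b n).integral_normed, fun n t ht => ?_, fun f hf => ?_⟩
  · have : t ∈ Function.support ((b n).normed volume) := ht
    rw [(b n).support_normed_eq, mem_ball_zero_iff] at this
    exact this.le
  · refine ContDiffBump.ae_convolution_tendsto_right_of_locallyIntegrable (K := 2)
      tendsto_one_div_add_two (Eventually.of_forall fun n => ?_) hf
    simp only [b]
    linarith

lemma IsTestFn.conv_sub {ρ f g : Phase d → ℝ} (hρ : IsTestFn ρ) (hf : LocallyIntegrable f volume)
    (hg : LocallyIntegrable g volume) (x : Phase d) :
    conv ρ (fun y => f y - g y) x = conv ρ f x - conv ρ g x := by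
  simp only [conv_apply, mul_sub]
  exact integral_sub
    (hρ.2.convolutionExists_left (ContinuousLinearMap.lsmul ℝ ℝ) hρ.1.continuous hf x)
    (hρ.2.convolutionExists_left (ContinuousLinearMap.lsmul ℝ ℝ) hρ.1.continuous hg x)

lemma IsMollifier.tendsto_integral_abs_sub_of_nonneg {ρ : ℕ → Phase d → ℝ} (hρ : IsMollifier ρ)
    {f : Phase d → ℝ} (hf : Integrable f) (hf0 : ∀ x, 0 ≤ f x) :
    Tendsto (fun n => ∫ x, |conv (ρ n) f x - f x|) atTop (𝓝 0) := by
  have hi : ∀ n, Integrable (conv (ρ n) f) := fun n =>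
    integrable_conv (hρ.isTestFn n).integrable hf
  have hp : ∀ n, Integrable (fun x => max (f x - conv (ρ n) f x) 0) := fun n =>
    (hf.sub (hi n)).pos_part
  have e : ∀ n, ∫ x, |conv (ρ n) f x - f x| = 2 * ∫ x, max (f x - conv (ρ n) f x) 0 := fun n => by
    have h0 : ∫ x, (conv (ρ n) f x - f x) = 0 := by
      rw [integral_sub (hi n) hf, integral_conv (hρ.isTestFn n).integrable hf,
        hρ.integral_eq_one, one_mul, sub_self]
    calc ∫ x, |conv (ρ n) f x - f x|
        = ∫ x, ((conv (ρ n) f x - f x) + 2 * max (f x - conv (ρ n) f x) 0) := by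
          congr 1
          ext x
          rcases le_total (f x - conv (ρ n) f x) 0 with h | h
          · rw [max_eq_right h, abs_of_nonneg (by linarith)]; ring
          · rw [max_eq_left h, abs_of_nonpos (by linarith)]; ring
      _ = _ := by
        have hs : Integrable (fun x => conv (ρ n) f x - f x) := (hi n).sub hf
        rw [integral_add hs ((hp n).const_mul _), h0, zero_add, integral_const_mul]
  simp only [e]
  have := tendsto_integral_of_dominated_convergence
    (F := fun n x => max (f x - conv (ρ n) f x) 0) (f := fun _ => (0 : ℝ)) f
    (fun n => (hp n).1) hf
    (fun n => Eventually.of_forall fun x => by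
      have h1 := conv_nonneg (hρ.nonneg n) hf0 x
      rw [Real.norm_eq_abs, abs_of_nonneg (le_max_right _ _)]
      exact max_le (by linarith) (hf0 x))
    (by
      filter_upwards [hρ.ae_tendsto f hf.locallyIntegrable] with x hx
      simpa using (hx.const_sub (f x)).max (tendsto_const_nhds (x := (0 : ℝ))))
  simpa using this.const_mul 2

lemma IsMollifier.tendsto_integral_abs_sub {ρ : ℕ → Phase d → ℝ} (hρ : IsMollifier ρ)
    {f : Phase d → ℝ} (hf : Integrable f) :
    Tendsto (fun n => ∫ x, |conv (ρ n) f x - f x|) atTop (𝓝 0) := by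
  have h1 := hρ.tendsto_integral_abs_sub_of_nonneg hf.pos_part fun x => le_max_right _ _
  have h2 := hρ.tendsto_integral_abs_sub_of_nonneg hf.neg_part fun x => le_max_right _ _
  have h3 := h1.add h2
  rw [add_zero] at h3
  refine squeeze_zero (fun n => integral_nonneg fun x => abs_nonneg _) (fun n => ?_) h3
  have i1 := ((integrable_conv (hρ.isTestFn n).integrable hf.pos_part).sub hf.pos_part).abs
  have i2 := ((integrable_conv (hρ.isTestFn n).integrable hf.neg_part).sub hf.neg_part).abs
  have e : ∀ x, f x = max (f x) 0 - max (-f x) 0 := fun x => by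
    rcases le_total (f x) 0 with h | h
    · rw [max_eq_right h, max_eq_left (by linarith)]; ring
    · rw [max_eq_left h, max_eq_right (by linarith)]; ring
  refine (integral_mono ((integrable_conv (hρ.isTestFn n).integrable hf).sub hf).abs (i1.add i2)
    fun x => ?_).trans_eq (integral_add i1 i2)
  have := (hρ.isTestFn n).conv_sub hf.pos_part.locallyIntegrable hf.neg_part.locallyIntegrable x
  simp only [← e] at this
  simp only [Pi.add_apply, Pi.sub_apply]
  have e' : conv (ρ n) f x - f x = (conv (ρ n) (fun a => max (f a) 0) x - max (f x) 0)
      - (conv (ρ n) (fun a => max (-f a) 0) x - max (-f x) 0) := by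
    linarith [e x]
  rw [e']
  exact abs_sub _ _

lemma IsMollifier.tendsto_integral_conv_mul {ρ : ℕ → Phase d → ℝ} (hρ : IsMollifier ρ)
    {f k : Phase d → ℝ} (hf : Integrable f) (hk : Continuous k) {C : ℝ} (hC : ∀ x, |k x| ≤ C) :
    Tendsto (fun n => ∫ x, conv (ρ n) f x * k x) atTop (𝓝 (∫ x, f x * k x)) := by
  have h1 : ∀ n, Integrable (fun x => conv (ρ n) f x * k x) := fun n =>
    Integrable.mul_of_bound (integrable_conv (hρ.isTestFn n).integrable hf) hk hC
  have h2 := Integrable.mul_of_bound hf hk hC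
  rw [tendsto_iff_norm_sub_tendsto_zero]
  have h3 := (hρ.tendsto_integral_abs_sub hf).mul_const C
  rw [zero_mul] at h3
  refine squeeze_zero (fun n => norm_nonneg _) (fun n => ?_) h3
  rw [← integral_sub (h1 n) h2, ← integral_mul_const]
  refine norm_integral_le_of_norm_le
    ((((integrable_conv (hρ.isTestFn n).integrable hf).sub hf).abs).mul_const C)
    (Eventually.of_forall fun x => ?_)
  rw [← sub_mul, Real.norm_eq_abs, abs_mul]
  exact mul_le_mul_of_nonneg_left (hC x) (abs_nonneg _)

/-- The duality bound extends from gradients `-∇_p φ` to arbitrary test vector fields. -/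
lemma sum_weakTerm_le {m c : ℝ} (hm : 0 < m) {f : Phase d → ℝ} (hf : Integrable f)
    (hf0 : ∀ x, 0 ≤ f x) (hc : ∀ φ, IsTestFn φ → 2 * ∫ x, f x * fisherIntegrand m φ x ≤ c)
    {ψ : Fin d → Phase d → ℝ} (hψ : ∀ i, IsTestFn (ψ i)) :
    ∑ i, weakTerm m f i (ψ i) ≤ c := by
  obtain ⟨ρ, hρ⟩ := exists_isMollifier d
  have hε := tendsto_one_div_add_two
  have t1 : Tendsto (fun n => ∑ i, weakTerm m (conv (ρ n) f) i (ψ i)) atTop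
      (𝓝 (∑ i, weakTerm m f i (ψ i))) := tendsto_finsetSum _ fun i _ => by
    have hk := (hψ i).weakTerm_kernel m i
    obtain ⟨C, -, hC⟩ := hk.exists_bound
    exact hρ.tendsto_integral_conv_mul hf hk.1.continuous hC
  have t2 : Tendsto (fun n : ℕ => (1 - 1 / ((n : ℝ) + 2))⁻¹ * c
      + d * (1 / ((n : ℝ) + 2) / m ^ 2) * ∫ x, f x) atTop (𝓝 c) := by
    have h1 := (((hε.const_sub 1).inv₀ (by norm_num)).mul_const c).add
      (((hε.div_const (m ^ 2)).const_mul (d : ℝ)).mul_const (∫ x, f x))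
    simpa using h1
  refine le_of_tendsto_of_tendsto' t1 t2 fun n => ?_
  have hn : (0 : ℝ) < 1 / ((n : ℝ) + 2) := by positivity
  have hn1 : (1 : ℝ) / ((n : ℝ) + 2) < 1 := by
    rw [div_lt_one (by positivity)]
    have : (0 : ℝ) ≤ n := n.cast_nonneg
    linarith
  have hs := (hρ.isTestFn n).smoothDensity_conv (hρ.nonneg n) hf hf0
  have := hs.sum_fieldTerm_le hm (fun φ hφ => fisher_conv_le hm hn hn1 hf hf0 hc
    (hρ.isTestFn n).integrable (hρ.nonneg n) (hρ.integral_eq_one n) (hρ.norm_le n) hφ) hψ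
  simpa only [weakTerm_eq_fieldTerm m hs.contDiff _ (hψ _)] using this

end Mollifier

section Riesz

variable {d : ℕ}

/-- Smooth compactly supported vector fields on phase space. -/
def testField (d : ℕ) : Submodule ℝ (Phase d → EuclideanSpace ℝ (Fin d)) where
  carrier := {Φ | ContDiff ℝ (⊤ : ℕ∞) Φ ∧ HasCompactSupport Φ}
  add_mem' h1 h2 := ⟨h1.1.add h2.1, h1.2.add h2.2⟩
  zero_mem' := ⟨contDiff_const, HasCompactSupport.zero⟩
  smul_mem' c _ h := ⟨h.1.const_smul c, h.2.comp_left (g := fun v => c • v) (smul_zero c)⟩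

lemma testField_memLp (ν : Measure (Phase d)) [IsFiniteMeasure ν] (Φ : testField d) :
    MemLp Φ.1 2 ν :=
  Φ.2.1.continuous.memLp_of_hasCompactSupport Φ.2.2

/-- The inclusion of test fields into `L²`. -/
def testFieldToLp (ν : Measure (Phase d)) [IsFiniteMeasure ν] :
    testField d →ₗ[ℝ] Lp (EuclideanSpace ℝ (Fin d)) 2 ν where
  toFun Φ := (testField_memLp ν Φ).toLp
  map_add' _ _ := MemLp.toLp_add _ _
  map_smul' c _ := MemLp.toLp_const_smul c _

lemma denseRange_testFieldToLp (ν : Measure (Phase d)) [IsFiniteMeasure ν] :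
    DenseRange (testFieldToLp ν) := by
  refine Dense.mono ?_ (Lp.dense_hasCompactSupport_contDiff (μ := ν) (p := 2) (by simp))
  rintro F ⟨g, hg, hgc, hgd⟩
  refine ⟨⟨g, hgd, hgc⟩, ?_⟩
  refine Lp.ext ?_
  exact (MemLp.coeFn_toLp (testField_memLp ν ⟨g, hgd, hgc⟩)).trans hg.symm

lemma exists_Lp_of_sq_le (ν : Measure (Phase d)) [IsFiniteMeasure ν] {c : ℝ} (hc : 0 ≤ c)
    (ℓ : testField d →ₗ[ℝ] ℝ) (hℓ : ∀ Φ, ℓ Φ ^ 2 ≤ c * ∫ x, ‖Φ.1 x‖ ^ 2 ∂ν) :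
    ∃ W : Lp (EuclideanSpace ℝ (Fin d)) 2 ν, ∫ x, ‖W x‖ ^ 2 ∂ν ≤ c ∧
      ∀ Φ, ℓ Φ = ∫ x, inner ℝ (W x) (Φ.1 x) ∂ν := by
  have hnorm : ∀ W : Lp (EuclideanSpace ℝ (Fin d)) 2 ν, ‖W‖ ^ 2 = ∫ x, ‖W x‖ ^ 2 ∂ν := fun W => by
    rw [← real_inner_self_eq_norm_sq, L2.inner_def]
    simp only [real_inner_self_eq_norm_sq]
  have hb : ∀ Φ, ‖ℓ Φ‖ ≤ √c * ‖testFieldToLp ν Φ‖ := fun Φ => by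
    rw [Real.norm_eq_abs, ← Real.sqrt_sq (norm_nonneg (testFieldToLp ν Φ)), ← Real.sqrt_mul hc]
    refine Real.abs_le_sqrt ?_
    rw [hnorm]
    refine (hℓ Φ).trans_eq ?_
    congr 1
    refine integral_congr_ae ?_
    filter_upwards [MemLp.coeFn_toLp (testField_memLp ν Φ)] with x hx
    rw [← hx]
    rfl
  have hd := denseRange_testFieldToLp ν
  set W := (InnerProductSpace.toDual ℝ _).symm (ℓ.extendOfNorm (testFieldToLp ν)) with hW
  refine ⟨W, ?_, fun Φ => ?_⟩
  · rw [← hnorm, hW, LinearIsometryEquiv.norm_map, ← Real.sq_sqrt hc]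
    exact pow_le_pow_left₀ (norm_nonneg _)
      (LinearMap.opNorm_extendOfNorm_le hd (Real.sqrt_nonneg c) hb) 2
  · rw [← LinearMap.extendOfNorm_eq hd ⟨_, hb⟩, ← InnerProductSpace.toDual_symm_apply, ← hW,
      L2.inner_def]
    refine integral_congr_ae ?_
    filter_upwards [MemLp.coeFn_toLp (testField_memLp ν Φ)] with x hx
    rw [← hx]
    rfl

lemma isTestFn_testField_apply (Φ : testField d) (i : Fin d) :
    IsTestFn (fun x => Φ.1 x i) :=
  ⟨(contDiff_euclidean (𝕜 := ℝ)).1 Φ.2.1 i, Φ.2.2.comp_left (g := fun v : EuclideanSpace ℝ (Fin d) => v i) rfl⟩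

/-- The kernel `-∂_{p_i} ψ + (p_i / m) ψ` of the formal adjoint of the momentum score. -/
lemma IsTestFn.scoreKernel {ψ : Phase d → ℝ} (hψ : IsTestFn ψ) (m : ℝ) (i : Fin d) :
    IsTestFn (fun x => -_root_.pdP ψ x i + x.2 i / m * ψ x) := by
  refine (hψ.pdP i).neg.add ?_
  have := hψ.mul_smooth ((contDiff_snd_apply i).div_const m)
  simpa only [mul_comm] using this

/-- The linear functional obtained from the duality formula. -/
def scoreFunctional (m : ℝ) (f : Phase d → ℝ) (hf : Integrable f) : testField d →ₗ[ℝ] ℝ where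
  toFun Φ := ∑ i, ∫ x, f x * (-pdP (fun y => Φ.1 y i) x i + x.2 i / m * Φ.1 x i)
  map_add' Φ Ψ := by
    rw [← Finset.sum_add_distrib]
    refine Finset.sum_congr rfl fun i _ => ?_
    have h1 := isTestFn_testField_apply Φ i
    have h2 := isTestFn_testField_apply Ψ i
    rw [← integral_add ((h1.scoreKernel m i).integrable_mul hf.locallyIntegrable)
      ((h2.scoreKernel m i).integrable_mul hf.locallyIntegrable)]
    refine integral_congr_ae (Eventually.of_forall fun x => ?_)
    have := pdP_add (h1.1.differentiable (by simp) x) (h2.1.differentiable (by simp) x) i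
    simp only [Submodule.coe_add, Pi.add_apply, PiLp.add_apply]
    rw [this]
    ring
  map_smul' c Φ := by
    simp only [RingHom.id_apply, smul_eq_mul]
    rw [Finset.mul_sum]
    refine Finset.sum_congr rfl fun i _ => ?_
    rw [← integral_const_mul]
    refine integral_congr_ae (Eventually.of_forall fun x => ?_)
    have := pdP_const_mul (φ := fun y => Φ.1 y i) (x := x) c i
    simp only [Submodule.coe_smul, Pi.smul_apply, PiLp.smul_apply, smul_eq_mul]
    rw [this]
    ring

lemma scoreFunctional_sq_le {m c : ℝ} (hm : 0 < m) {f : Phase d → ℝ} (hf : Integrable f)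
    (hf0 : ∀ x, 0 ≤ f x) (hc : ∀ φ, IsTestFn φ → 2 * ∫ x, f x * fisherIntegrand m φ x ≤ c)
    (Φ : testField d) : scoreFunctional m f hf Φ ^ 2 ≤ c * ∫ x, f x * ‖Φ.1 x‖ ^ 2 := by
  have hT := isTestFn_testField_apply Φ
  have hsq : ∀ i, Integrable (fun x => f x * Φ.1 x i ^ 2) := fun i => by
    simpa only [sq] using ((hT i).mul_smooth (hT i).1).integrable_mul hf.locallyIntegrable
  have hq : ∫ x, f x * ‖Φ.1 x‖ ^ 2 = ∑ i, ∫ x, f x * Φ.1 x i ^ 2 := by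
    rw [← integral_finsetSum _ fun i _ => hsq i]
    refine integral_congr_ae (Eventually.of_forall fun x => ?_)
    simp only [EuclideanSpace.real_norm_sq_eq, Finset.mul_sum]
  have h : ∀ s : ℝ, 0 ≤ (∫ x, f x * ‖Φ.1 x‖ ^ 2) * (s * s)
      + (-2 * scoreFunctional m f hf Φ) * s + c := fun s => by
    have h1 := sum_weakTerm_le hm hf hf0 hc (ψ := fun i x => s * Φ.1 x i)
      fun i => (hT i).const_mul s
    have h2 : ∀ i, weakTerm m f i (fun x => s * Φ.1 x i)
        = 2 * s * (∫ x, f x * (-pdP (fun y => Φ.1 y i) x i + x.2 i / m * Φ.1 x i))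
          - s ^ 2 * ∫ x, f x * Φ.1 x i ^ 2 := fun i => by
      rw [← integral_const_mul, ← integral_const_mul, ← integral_sub
        ((((hT i).scoreKernel m i).integrable_mul hf.locallyIntegrable).const_mul _)
        ((hsq i).const_mul _)]
      refine integral_congr_ae (Eventually.of_forall fun x => ?_)
      simp only [pdP_const_mul (φ := fun y => Φ.1 y i)]
      ring
    simp only [h2, Finset.sum_sub_distrib, ← Finset.mul_sum] at h1
    rw [hq]
    have e : scoreFunctional m f hf Φ
      = ∑ i, ∫ x, f x * (-pdP (fun y => Φ.1 y i) x i + x.2 i / m * Φ.1 x i) := rfl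
    rw [e]
    linarith
  have := discrim_le_zero h
  unfold discrim at this
  nlinarith

/-- The test field with a single nonzero component. -/
def singleField (i : Fin d) {ψ : Phase d → ℝ} (hψ : IsTestFn ψ) : testField d :=
  ⟨fun x => ψ x • EuclideanSpace.single i (1 : ℝ), hψ.1.smul contDiff_const,
    hψ.2.comp_left (g := fun t : ℝ => t • EuclideanSpace.single i (1 : ℝ)) (zero_smul _ _)⟩

lemma integral_withDensity_ofReal {f : Phase d → ℝ} (hf : Integrable f) (hf0 : ∀ x, 0 ≤ f x)
    (g : Phase d → ℝ) :
    ∫ x, g x ∂(volume.withDensity fun x => ENNReal.ofReal (f x)) = ∫ x, f x * g x := by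
  rw [integral_withDensity_eq_integral_toReal_smul₀ hf.1.aemeasurable.ennreal_ofReal
    (Eventually.of_forall fun x => ENNReal.ofReal_lt_top)]
  simp only [ENNReal.toReal_ofReal (hf0 _), smul_eq_mul]

lemma integrable_withDensity_ofReal {f : Phase d → ℝ} (hf : Integrable f) (hf0 : ∀ x, 0 ≤ f x)
    {g : Phase d → ℝ} :
    Integrable g (volume.withDensity fun x => ENNReal.ofReal (f x)) ↔
      Integrable (fun x => f x * g x) := by
  rw [integrable_withDensity_iff_integrable_smul₀' hf.1.aemeasurable.ennreal_ofReal
    (Eventually.of_forall fun x => ENNReal.ofReal_lt_top)]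
  simp only [ENNReal.toReal_ofReal (hf0 _), smul_eq_mul]

/-- A finite Fisher information yields a score `w ∈ L²(f dx)` of norm at most the information. -/
lemma exists_score {m c : ℝ} (hm : 0 < m) {f : Phase d → ℝ} (hf : Integrable f)
    (hf0 : ∀ x, 0 ≤ f x) (hc : ∀ φ, IsTestFn φ → 2 * ∫ x, f x * fisherIntegrand m φ x ≤ c) :
    ∃ w : Phase d → Fin d → ℝ, Integrable (fun x => f x * ∑ i, w x i ^ 2) ∧
      ∫ x, f x * ∑ i, w x i ^ 2 ≤ c ∧ (∀ i, Integrable (fun x => f x * w x i)) ∧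
      ∀ i ψ, IsTestFn ψ → ∫ x, f x * (-pdP ψ x i + x.2 i / m * ψ x) = ∫ x, f x * w x i * ψ x := by
  set ν : Measure (Phase d) := volume.withDensity fun x => ENNReal.ofReal (f x) with hν
  have : IsFiniteMeasure ν := isFiniteMeasure_withDensity_ofReal hf.2
  have hc0 : 0 ≤ c := by
    have := hc _ IsTestFn.zero
    simpa [two_mul_integral_fisherIntegrand m hf.locallyIntegrable IsTestFn.zero, weakTerm, pdP]
      using this
  obtain ⟨W, hW1, hW2⟩ := exists_Lp_of_sq_le ν hc0 (scoreFunctional m f hf) fun Φ => by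
    rw [hν, integral_withDensity_ofReal hf hf0]
    exact scoreFunctional_sq_le hm hf hf0 hc Φ
  have hWL := Lp.memLp W
  have hWi : ∀ i, MemLp (fun x => W x i) 2 ν := fun i => hWL.eval_piLp i
  refine ⟨fun x i => W x i, ?_, ?_, fun i => ?_, fun i ψ hψ => ?_⟩
  · rw [← integrable_withDensity_ofReal hf hf0]
    exact integrable_finsetSum _ fun i _ => (hWi i).integrable_sq
  · rw [← integral_withDensity_ofReal hf hf0, ← hν]
    simpa only [EuclideanSpace.real_norm_sq_eq] using hW1
  · rw [← integrable_withDensity_ofReal hf hf0]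
    exact (hWi i).integrable one_le_two
  · have h := (hW2 (singleField i hψ)).trans (integral_withDensity_ofReal hf hf0 _)
    have e1 : scoreFunctional m f hf (singleField i hψ)
        = ∫ x, f x * (-pdP ψ x i + x.2 i / m * ψ x) := by
      have e : scoreFunctional m f hf (singleField i hψ) = ∑ j, ∫ x, f x *
        (-pdP (fun y => (singleField i hψ).1 y j) x j + x.2 j / m * (singleField i hψ).1 x j) := rfl
      rw [e, Finset.sum_eq_single i]
      · simp [singleField]
      · intro j _ hj
        simp [singleField, hj, pdP]
      · simp
    rw [← e1, h]
    refine integral_congr_ae (Eventually.of_forall fun x => ?_)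
    simp only [singleField, real_inner_smul_right, EuclideanSpace.inner_single_right]
    simp
    ring

end Riesz

section Stampacchia

variable {d : ℕ}

lemma IsTestFn.comp_sub_left {φ : Phase d → ℝ} (hφ : IsTestFn φ) (x : Phase d) :
    IsTestFn (fun y => φ (x - y)) :=
  ⟨hφ.1.comp (contDiff_const.sub contDiff_id), hφ.2.comp_homeomorph (Homeomorph.subLeft x)⟩

lemma IsTestFn.pdP_comp_sub_left {φ : Phase d → ℝ} (hφ : IsTestFn φ) (x y : Phase d) (i : Fin d) :
    _root_.pdP (fun z => φ (x - z)) y i = -_root_.pdP φ (x - y) i := by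
  have h1 : HasFDerivAt (fun z : Phase d => x - z) (-ContinuousLinearMap.id ℝ (Phase d)) y :=
    (hasFDerivAt_id y).const_sub x
  have h2 := (hφ.1.differentiable (by simp) (x - y)).hasFDerivAt
  simp only [_root_.pdP]
  rw [show (fun z => φ (x - z)) = φ ∘ fun z => x - z from rfl, (h2.comp y h1).fderiv]
  simp

/-- Mollification commutes with weak differentiation. -/
lemma IsTestFn.pdP_conv_eq_conv {ρ F H : Phase d → ℝ} (hρ : IsTestFn ρ)
    (hF : LocallyIntegrable F volume) {i : Fin d}
    (hH : ∀ φ, IsTestFn φ → ∫ x, F x * _root_.pdP φ x i = -∫ x, H x * φ x) (x : Phase d) :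
    _root_.pdP (conv ρ F) x i = conv ρ H x := by
  have h := hH _ (hρ.comp_sub_left x)
  simp only [hρ.pdP_comp_sub_left, mul_neg, integral_neg, neg_inj] at h
  rw [hρ.pdP_conv hF, conv_apply, conv_apply, ← integral_sub_left_eq_self _ volume x,
    ← integral_sub_left_eq_self (fun t => ρ t * H (x - t)) volume x]
  simpa only [sub_sub_cancel, mul_comm] using h

lemma hasDerivAt_mul_div_add {δ t : ℝ} (hδ : 0 < δ) (ht : 0 ≤ t) :
    HasDerivAt (fun s => δ * s / (δ + s)) (δ ^ 2 / (δ + t) ^ 2) t := by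
  have h : δ + t ≠ 0 := by positivity
  refine (((hasDerivAt_id t).const_mul δ).div ((hasDerivAt_id t).const_add δ) h).congr_deriv ?_
  simp only [id]
  ring

lemma abs_mul_div_add_le {δ t : ℝ} (hδ : 0 < δ) (ht : 0 ≤ t) : |δ * t / (δ + t)| ≤ δ := by
  rw [abs_of_nonneg (by positivity), div_le_iff₀ (by positivity)]
  nlinarith

lemma abs_sq_div_add_sq_le_one {δ t : ℝ} (hδ : 0 < δ) (ht : 0 ≤ t) :
    |δ ^ 2 / (δ + t) ^ 2| ≤ 1 := by
  rw [abs_of_nonneg (by positivity), div_le_one (by positivity)]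
  nlinarith

lemma continuousAt_mul_div_add {δ t : ℝ} (hδ : 0 < δ) (ht : 0 ≤ t) :
    ContinuousAt (fun s => δ * s / (δ + s)) t :=
  (hasDerivAt_mul_div_add hδ ht).continuousAt

lemma continuousAt_sq_div_add_sq {δ t : ℝ} (hδ : 0 < δ) (ht : 0 ≤ t) :
    ContinuousAt (fun s => δ ^ 2 / (δ + s) ^ 2) t :=
  continuousAt_const.div (by fun_prop) (by positivity)

/-- Chain rule for the truncations `s ↦ δ s / (δ + s)` of a weakly differentiable function. -/
lemma integral_truncation_mul_pdP {F H : Phase d → ℝ} (hF : Integrable F) (hF0 : ∀ x, 0 ≤ F x)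
    (hHi : Integrable H) {i : Fin d}
    (hH : ∀ φ, IsTestFn φ → ∫ x, F x * pdP φ x i = -∫ x, H x * φ x) {δ : ℝ} (hδ : 0 < δ)
    {φ : Phase d → ℝ} (hφ : IsTestFn φ) :
    ∫ x, δ * F x / (δ + F x) * pdP φ x i = -∫ x, δ ^ 2 / (δ + F x) ^ 2 * H x * φ x := by
  obtain ⟨ρ, hρ⟩ := exists_isMollifier d
  obtain ⟨C, -, hC⟩ := hφ.exists_bound
  have hC0 : 0 ≤ C := (abs_nonneg _).trans (hC 0)
  have hFn0 : ∀ n x, 0 ≤ conv (ρ n) F x := fun n => conv_nonneg (hρ.nonneg n) hF0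
  have hFs : ∀ n, ContDiff ℝ (⊤ : ℕ∞) (conv (ρ n) F) := fun n =>
    (hρ.isTestFn n).contDiff_conv hF.locallyIntegrable
  have hHs : ∀ n, ContDiff ℝ (⊤ : ℕ∞) (conv (ρ n) H) := fun n =>
    (hρ.isTestFn n).contDiff_conv hHi.locallyIntegrable
  have hsc : ∀ n, Continuous fun x => δ ^ 2 / (δ + conv (ρ n) F x) ^ 2 := fun n =>
    continuous_const.div ((continuous_const.add (hFs n).continuous).pow 2)
      fun x => by have := hFn0 n x; positivity
  have hts : ∀ n, ContDiff ℝ (⊤ : ℕ∞) fun x => δ * conv (ρ n) F x / (δ + conv (ρ n) F x) :=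
    fun n => (contDiff_const.mul (hFs n)).div (contDiff_const.add (hFs n))
      fun x => by have := hFn0 n x; positivity
  have hibp : ∀ n, ∫ x, δ * conv (ρ n) F x / (δ + conv (ρ n) F x) * pdP φ x i
      = -∫ x, δ ^ 2 / (δ + conv (ρ n) F x) ^ 2 * conv (ρ n) H x * φ x := fun n => by
    have e : ∀ x, pdP (fun x => δ * conv (ρ n) F x / (δ + conv (ρ n) F x)) x i
        = δ ^ 2 / (δ + conv (ρ n) F x) ^ 2 * conv (ρ n) H x := fun x => by
      rw [pdP_comp (h := fun s => δ * s / (δ + s)) (hasDerivAt_mul_div_add hδ (hFn0 n x))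
        ((hFs n).differentiable (by simp) x),
        (hρ.isTestFn n).pdP_conv_eq_conv hF.locallyIntegrable hH]
    simp only [← e]
    refine integral_mul_pdP i ((hts n).differentiable (by simp)) (hφ.1.differentiable (by simp))
      (hφ.integrable_mul ?_) ((hφ.pdP i).integrable_mul ?_) (hφ.integrable_mul ?_)
    · exact (ContDiff.pdP (hts n) i).continuous.locallyIntegrable
    · exact (hts n).continuous.locallyIntegrable
    · exact (hts n).continuous.locallyIntegrable
  have hae := hρ.ae_tendsto F hF.locallyIntegrable
  have hlim1 : Tendsto (fun n => ∫ x, δ * conv (ρ n) F x / (δ + conv (ρ n) F x) * pdP φ x i) atTop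
      (𝓝 (∫ x, δ * F x / (δ + F x) * pdP φ x i)) := by
    refine tendsto_integral_of_dominated_convergence (fun x => δ * |pdP φ x i|)
      (fun n => ((hts n).continuous.mul (hφ.pdP i).1.continuous).aestronglyMeasurable)
      ((hφ.pdP i).integrable.abs.const_mul δ)
      (fun n => Eventually.of_forall fun x => ?_) ?_
    · rw [Real.norm_eq_abs, abs_mul]
      exact mul_le_mul_of_nonneg_right (abs_mul_div_add_le hδ (hFn0 n x)) (abs_nonneg _)
    · filter_upwards [hae] with x hx
      exact ((continuousAt_mul_div_add hδ (hF0 x)).tendsto.comp hx).mul_const _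
  have hlim2 : Tendsto (fun n => ∫ x, δ ^ 2 / (δ + conv (ρ n) F x) ^ 2 * H x * φ x) atTop
      (𝓝 (∫ x, δ ^ 2 / (δ + F x) ^ 2 * H x * φ x)) := by
    refine tendsto_integral_of_dominated_convergence (fun x => |H x| * C)
      (fun n => ((hsc n).aestronglyMeasurable.mul hHi.1).mul hφ.1.continuous.aestronglyMeasurable)
      (hHi.abs.mul_const C) (fun n => Eventually.of_forall fun x => ?_) ?_
    · rw [Real.norm_eq_abs, abs_mul, abs_mul]
      have h1 := abs_sq_div_add_sq_le_one hδ (hFn0 n x)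
      have h2 := mul_le_mul_of_nonneg_right h1 (abs_nonneg (H x))
      rw [one_mul] at h2
      exact mul_le_mul h2 (hC x) (abs_nonneg _) (abs_nonneg _)
    · filter_upwards [hae] with x hx
      exact (((continuousAt_sq_div_add_sq hδ (hF0 x)).tendsto.comp hx).mul_const _).mul_const _
  have hi1 : ∀ n, Integrable (fun x => δ ^ 2 / (δ + conv (ρ n) F x) ^ 2 * conv (ρ n) H x * φ x) :=
    fun n => hφ.integrable_mul ((hsc n).mul (hHs n).continuous).locallyIntegrable
  have hi2 : ∀ n, Integrable (fun x => δ ^ 2 / (δ + conv (ρ n) F x) ^ 2 * H x * φ x) :=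
    fun n => by
      refine hφ.integrable_mul (Integrable.locallyIntegrable ?_)
      simpa only [mul_comm] using _root_.Integrable.mul_of_bound hHi (hsc n) (C := 1)
        fun x => abs_sq_div_add_sq_le_one hδ (hFn0 n x)
  have hlim3 : Tendsto (fun n => (∫ x, δ ^ 2 / (δ + conv (ρ n) F x) ^ 2 * conv (ρ n) H x * φ x)
      - ∫ x, δ ^ 2 / (δ + conv (ρ n) F x) ^ 2 * H x * φ x) atTop (𝓝 0) := by
    have h0 := (hρ.tendsto_integral_abs_sub hHi).mul_const C
    rw [zero_mul] at h0
    refine squeeze_zero_norm (fun n => ?_) h0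
    rw [← integral_sub (hi1 n) (hi2 n), ← integral_mul_const]
    refine norm_integral_le_of_norm_le
      ((((integrable_conv (hρ.isTestFn n).integrable hHi).sub hHi).abs).mul_const C)
      (Eventually.of_forall fun x => ?_)
    rw [← sub_mul, ← mul_sub, Real.norm_eq_abs, abs_mul, abs_mul]
    have h1 := abs_sq_div_add_sq_le_one hδ (hFn0 n x)
    have h2 := mul_le_mul_of_nonneg_right h1 (abs_nonneg (conv (ρ n) H x - H x))
    rw [one_mul] at h2
    exact mul_le_mul h2 (hC x) (abs_nonneg _) (abs_nonneg _)
  have hlim4 := (hlim3.add hlim2).neg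
  simp only [sub_add_cancel, zero_add, ← hibp] at hlim4
  exact tendsto_nhds_unique hlim1 hlim4

/-- The weak derivative of a nonnegative integrable function vanishes a.e. on its zero set. -/
lemma ae_eq_zero_of_integrable {F H : Phase d → ℝ} (hF : Integrable F)
    (hF0 : ∀ x, 0 ≤ F x) (hHi : Integrable H) {i : Fin d}
    (hH : ∀ φ, IsTestFn φ → ∫ x, F x * pdP φ x i = -∫ x, H x * φ x) :
    ∀ᵐ x, F x = 0 → H x = 0 := by
  classical
  set δ : ℕ → ℝ := fun n => 1 / ((n : ℝ) + 2) with hδd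
  have hδ : ∀ n, 0 < δ n := fun n => by positivity
  have hδ0 : Tendsto δ atTop (𝓝 0) := tendsto_one_div_add_two
  set g : Phase d → ℝ := fun x => if F x = 0 then H x else 0 with hg
  have hpt : ∀ x, Tendsto (fun n => δ n ^ 2 / (δ n + F x) ^ 2 * H x) atTop (𝓝 (g x)) := fun x => by
    by_cases hx : F x = 0
    · have e : ∀ n, δ n ^ 2 / (δ n + F x) ^ 2 * H x = g x := fun n => by
        have := (hδ n).ne'
        simp only [hg, hx, if_true, add_zero]
        field_simp
      simp only [e]
      exact tendsto_const_nhds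
    · have h1 : Tendsto (fun n => δ n ^ 2 / (δ n + F x) ^ 2 * H x) atTop
          (𝓝 (0 ^ 2 / (0 + F x) ^ 2 * H x)) :=
        ((hδ0.pow 2).div ((hδ0.add_const _).pow 2) (by simpa using hx)).mul_const _
      simpa [hg, hx] using h1
  have hm : ∀ n, AEStronglyMeasurable (fun x => δ n ^ 2 / (δ n + F x) ^ 2 * H x) volume := fun n =>
    ((((hF.1.aemeasurable.const_add _).pow_const 2).const_div _).mul
      hHi.1.aemeasurable).aestronglyMeasurable
  have hb : ∀ n x, |δ n ^ 2 / (δ n + F x) ^ 2 * H x| ≤ |H x| := fun n x => by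
    rw [abs_mul]
    exact mul_le_of_le_one_left (abs_nonneg _) (abs_sq_div_add_sq_le_one (hδ n) (hF0 x))
  have hgi : Integrable g := hHi.mono
    (aestronglyMeasurable_of_tendsto_ae atTop hm (Eventually.of_forall hpt))
    (Eventually.of_forall fun x => by simp only [hg]; split_ifs <;> simp)
  have hg0 : ∀ᵐ x, g x = 0 := by
    refine ae_eq_zero_of_integral_contDiff_smul_eq_zero hgi.locallyIntegrable
      fun φ hφs hφc => ?_
    have hφ : IsTestFn φ := ⟨hφs, hφc⟩
    obtain ⟨C, -, hC⟩ := hφ.exists_bound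
    have h1 : Tendsto (fun n => ∫ x, δ n ^ 2 / (δ n + F x) ^ 2 * H x * φ x) atTop
        (𝓝 (∫ x, g x * φ x)) := by
      refine tendsto_integral_of_dominated_convergence (fun x => |H x| * C)
        (fun n => (hm n).mul hφ.1.continuous.aestronglyMeasurable) (hHi.abs.mul_const C)
        (fun n => Eventually.of_forall fun x => ?_)
        (Eventually.of_forall fun x => (hpt x).mul_const _)
      rw [Real.norm_eq_abs, abs_mul]
      exact mul_le_mul (hb n x) (hC x) (abs_nonneg _) (abs_nonneg _)
    have h2 : Tendsto (fun n => ∫ x, δ n * F x / (δ n + F x) * pdP φ x i) atTop (𝓝 0) := by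
      have h0 := hδ0.mul_const (∫ x, |pdP φ x i|)
      rw [zero_mul] at h0
      refine squeeze_zero_norm (fun n => ?_) h0
      rw [← integral_const_mul]
      refine norm_integral_le_of_norm_le ((hφ.pdP i).integrable.abs.const_mul _)
        (Eventually.of_forall fun x => ?_)
      rw [Real.norm_eq_abs, abs_mul]
      exact mul_le_mul_of_nonneg_right (abs_mul_div_add_le (hδ n) (hF0 x)) (abs_nonneg _)
    have h3 := h1.neg
    simp only [← integral_truncation_mul_pdP hF hF0 hHi hH (hδ _) hφ] at h3
    have := tendsto_nhds_unique h2 h3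
    simp only [smul_eq_mul, mul_comm (φ _)]
    linarith
  filter_upwards [hg0] with x hx h
  simpa [hg, h] using hx

/-- The product rule for weak derivatives. -/
lemma IsWeakPGrad.integral_mul_testFn {f : Phase d → ℝ} {G : Phase d → Fin d → ℝ}
    (hG : IsWeakPGrad f G) (hf : LocallyIntegrable f volume) {η : Phase d → ℝ} (hη : IsTestFn η)
    (i : Fin d) {φ : Phase d → ℝ} (hφ : IsTestFn φ) :
    ∫ x, f x * η x * pdP φ x i = -∫ x, (G x i * η x + f x * pdP η x i) * φ x := by
  have h1 := hG.2 _ (hη.mul_smooth hφ.1) i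
  have e : ∀ x, pdP (fun y => η y * φ y) x i = η x * pdP φ x i + φ x * pdP η x i := fun x =>
    pdP_mul (hη.1.differentiable (by simp) x) (hφ.1.differentiable (by simp) x) i
  have i1 : Integrable (fun x => f x * η x * pdP φ x i) := by
    simpa only [mul_assoc] using (hη.mul_smooth (hφ.pdP i).1).integrable_mul hf
  have i2 : Integrable (fun x => f x * pdP η x i * φ x) := by
    simpa only [mul_assoc] using ((hη.pdP i).mul_smooth hφ.1).integrable_mul hf
  have i3 : Integrable (fun x => G x i * η x * φ x) := by
    simpa only [mul_assoc] using (hη.mul_smooth hφ.1).integrable_mul (hG.1 i)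
  have h2 : ∫ x, f x * pdP (fun y => η y * φ y) x i
      = (∫ x, f x * η x * pdP φ x i) + ∫ x, f x * pdP η x i * φ x := by
    rw [← integral_add i1 i2]
    refine integral_congr_ae (Eventually.of_forall fun x => ?_)
    simp only [e]
    ring
  have h3 : ∫ x, (G x i * η x + f x * pdP η x i) * φ x
      = (∫ x, G x i * η x * φ x) + ∫ x, f x * pdP η x i * φ x := by
    simp only [add_mul]
    exact integral_add i3 i2
  simp only [← mul_assoc] at h1
  rw [h3]
  linarith

/-- The weak gradient of a nonnegative function vanishes a.e. on its zero set. -/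
lemma IsWeakPGrad.ae_eq_zero {f : Phase d → ℝ} {G : Phase d → Fin d → ℝ} (hG : IsWeakPGrad f G)
    (hf : LocallyIntegrable f volume) (hf0 : ∀ x, 0 ≤ f x) :
    ∀ᵐ x, f x = 0 → ∀ i, G x i = 0 := by
  obtain ⟨χ, hχ, -, hχ1, -⟩ := exists_cutoff d
  have hη : ∀ n, IsTestFn (fun x => χ n x * χ n x) := fun n => (hχ n).mul_smooth (hχ n).1
  have key : ∀ i n, ∀ᵐ x, f x * (χ n x * χ n x) = 0 →
      G x i * (χ n x * χ n x) + f x * pdP (fun y => χ n y * χ n y) x i = 0 := fun i n =>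
    ae_eq_zero_of_integrable ((hη n).integrable_mul hf)
      (fun x => mul_nonneg (hf0 x) (mul_self_nonneg _))
      (((hη n).integrable_mul (hG.1 i)).add (((hη n).pdP i).integrable_mul hf))
      fun φ hφ => hG.integral_mul_testFn hf (hη n) i hφ
  filter_upwards [ae_all_iff.2 fun i => ae_all_iff.2 (key i)] with x hx h0 i
  have h1 : ∀ n, G x i * (χ n x * χ n x) = 0 := fun n => by
    simpa [h0] using hx i n
  have h2 := ((hχ1 x).mul (hχ1 x)).const_mul (G x i)
  simp only [h1, mul_one] at h2
  exact tendsto_nhds_unique h2 tendsto_const_nhds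

end Stampacchia

section Duality

variable {d : ℕ}

lemma relFisher_withDensity (m : ℝ) {f : Phase d → ℝ} (hf : Integrable f) (hf0 : ∀ x, 0 ≤ f x) :
    relFisher m (volume.withDensity fun x => ENNReal.ofReal (f x))
      = ⨆ φ : {φ : Phase d → ℝ // IsTestFn φ},
        ENNReal.ofReal (2 * ∫ x, f x * fisherIntegrand m φ.1 x) := by
  simp only [relFisher, integral_withDensity_ofReal hf hf0]

lemma le_toReal_relFisher {m : ℝ} {f : Phase d → ℝ} (hf : Integrable f) (hf0 : ∀ x, 0 ≤ f x)
    (h : relFisher m (volume.withDensity fun x => ENNReal.ofReal (f x)) ≠ ⊤)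
    {φ : Phase d → ℝ} (hφ : IsTestFn φ) :
    2 * ∫ x, f x * fisherIntegrand m φ x
      ≤ (relFisher m (volume.withDensity fun x => ENNReal.ofReal (f x))).toReal := by
  rw [← ENNReal.ofReal_le_iff_le_toReal h, relFisher_withDensity m hf hf0]
  exact le_iSup (fun φ : {φ : Phase d → ℝ // IsTestFn φ} =>
    ENNReal.ofReal (2 * ∫ x, f x * fisherIntegrand m φ.1 x)) ⟨φ, hφ⟩

lemma isWeakPGrad_of_score {m : ℝ} {f : Phase d → ℝ} (hf : LocallyIntegrable f volume)
    {w : Phase d → Fin d → ℝ} (hwi : ∀ i, LocallyIntegrable (fun x => f x * w x i) volume)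
    (hw : ∀ i ψ, IsTestFn ψ →
      ∫ x, f x * (-pdP ψ x i + x.2 i / m * ψ x) = ∫ x, f x * w x i * ψ x) :
    IsWeakPGrad f fun x i => f x * w x i - f x * (x.2 i / m) := by
  have hfP : ∀ i, LocallyIntegrable (fun x : Phase d => f x * (x.2 i / m)) volume := fun i => by
    have hc : Continuous fun x : Phase d => x.2 i / m :=
      (contDiff_snd_apply i).continuous.div_const m
    have := (hf.locallyIntegrableOn univ).mul_continuousOn hc.continuousOn
      isOpen_univ.isLocallyClosed
    rwa [locallyIntegrableOn_univ] at this
  refine ⟨fun i => (hwi i).sub (hfP i), fun φ hφ i => ?_⟩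
  have h := hw i φ hφ
  have i1 := hφ.integrable_mul (hwi i)
  have i2 := hφ.integrable_mul (hfP i)
  have i3 := (hφ.pdP i).integrable_mul hf
  have e1 : ∫ x, f x * (-pdP φ x i + x.2 i / m * φ x)
      = (∫ x, f x * (x.2 i / m) * φ x) - ∫ x, f x * pdP φ x i := by
    rw [← integral_sub i2 i3]
    exact integral_congr_ae (Eventually.of_forall fun x => by simp only []; ring)
  have e2 : ∫ x, (f x * w x i - f x * (x.2 i / m)) * φ x
      = (∫ x, f x * w x i * φ x) - ∫ x, f x * (x.2 i / m) * φ x := by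
    rw [← integral_sub i1 i2]
    exact integral_congr_ae (Eventually.of_forall fun x => by simp only []; ring)
  simp only [e2]
  linarith

/-- Weak gradients are unique almost everywhere. -/
lemma IsWeakPGrad.ae_eq {f : Phase d → ℝ} {G G' : Phase d → Fin d → ℝ} (hG : IsWeakPGrad f G)
    (hG' : IsWeakPGrad f G') : ∀ᵐ x, ∀ i, G x i = G' x i := by
  refine ae_all_iff.2 fun i => ?_
  refine ae_eq_of_integral_contDiff_smul_eq (hG.1 i) (hG'.1 i) fun φ hφs hφc => ?_
  have h1 := hG.2 φ ⟨hφs, hφc⟩ i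
  have h2 := hG'.2 φ ⟨hφs, hφc⟩ i
  simp only [smul_eq_mul, mul_comm (φ _)]
  linarith

lemma IsWeakPGrad.weakTerm_eq {f : Phase d → ℝ} {G : Phase d → Fin d → ℝ} (hG : IsWeakPGrad f G)
    (hf : LocallyIntegrable f volume) (m : ℝ) (i : Fin d) {ψ : Phase d → ℝ} (hψ : IsTestFn ψ) :
    Integrable (fun x => 2 * (G x i + f x * (x.2 i / m)) * ψ x - f x * ψ x ^ 2) ∧
      weakTerm m f i ψ = ∫ x, (2 * (G x i + f x * (x.2 i / m)) * ψ x - f x * ψ x ^ 2) := by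
  have i1 : Integrable (fun x => f x * (2 * (x.2 i / m) * ψ x - ψ x ^ 2)) := by
    have h1 := (hψ.mul_smooth ((contDiff_snd_apply i).div_const m)).integrable_mul hf
    have h2 := (hψ.mul_smooth hψ.1).integrable_mul hf
    convert (h1.const_mul 2).sub h2 using 1
    ext x
    simp only [Pi.sub_apply]
    ring
  have i2 := (hψ.integrable_mul (hG.1 i)).const_mul 2
  have i3 := ((hψ.pdP i).integrable_mul hf).const_mul (-2)
  have e : ∀ x, 2 * (G x i + f x * (x.2 i / m)) * ψ x - f x * ψ x ^ 2
      = 2 * (G x i * ψ x) + f x * (2 * (x.2 i / m) * ψ x - ψ x ^ 2) := fun x => by ring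
  have e' : ∀ x, f x * (-2 * pdP ψ x i + 2 * (x.2 i / m) * ψ x - ψ x ^ 2)
      = -2 * (f x * pdP ψ x i) + f x * (2 * (x.2 i / m) * ψ x - ψ x ^ 2) := fun x => by ring
  unfold weakTerm
  simp only [e, e']
  refine ⟨i2.add i1, ?_⟩
  rw [integral_add i2 i1, integral_add i3 i1, integral_const_mul, integral_const_mul,
    hG.2 ψ hψ i]
  ring

lemma ofReal_integral_le_lintegral {α : Type*} [MeasurableSpace α] {μ : Measure α} {k : α → ℝ}
    (hk : Integrable k μ) : ENNReal.ofReal (∫ x, k x ∂μ) ≤ ∫⁻ x, ENNReal.ofReal (k x) ∂μ := by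
  calc ENNReal.ofReal (∫ x, k x ∂μ) ≤ ENNReal.ofReal (∫ x, max (k x) 0 ∂μ) :=
        ENNReal.ofReal_le_ofReal (integral_mono hk hk.pos_part fun x => le_max_left _ _)
    _ = ∫⁻ x, ENNReal.ofReal (max (k x) 0) ∂μ :=
        ofReal_integral_eq_lintegral_ofReal hk.pos_part
          (Eventually.of_forall fun x => le_max_right _ _)
    _ = ∫⁻ x, ENNReal.ofReal (k x) ∂μ := by simp

lemma IsWeakPGrad.relFisher_le {m : ℝ} {f : Phase d → ℝ} (hf : Integrable f)
    (hf0 : ∀ x, 0 ≤ f x) {G : Phase d → Fin d → ℝ} (hG : IsWeakPGrad f G) :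
    relFisher m (volume.withDensity fun x => ENNReal.ofReal (f x))
      ≤ ∫⁻ x, ENNReal.ofReal ((∑ i, (({y : Phase d | 0 < f y}.indicator
          (fun y => G y i / f y) x) + x.2 i / m) ^ 2) * f x) := by
  rw [relFisher_withDensity m hf hf0]
  refine iSup_le fun φ => ?_
  have hψ : ∀ i, IsTestFn fun x => -pdP φ.1 x i := fun i => (φ.2.pdP i).neg
  have hk := fun i => hG.weakTerm_eq hf.locallyIntegrable m i (hψ i)
  rw [two_mul_integral_fisherIntegrand m hf.locallyIntegrable φ.2,
    Finset.sum_congr rfl fun i _ => (hk i).2, ← integral_finsetSum _ fun i _ => (hk i).1]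
  refine (ofReal_integral_le_lintegral (integrable_finsetSum _ fun i _ => (hk i).1)).trans ?_
  refine lintegral_mono_ae ?_
  filter_upwards [hG.ae_eq_zero hf.locallyIntegrable hf0] with x hx
  refine ENNReal.ofReal_le_ofReal ?_
  rw [Finset.sum_mul]
  refine Finset.sum_le_sum fun i _ => ?_
  rcases (hf0 x).eq_or_lt with h | h
  · simp [← h, hx h.symm i]
  · have hi : {y : Phase d | 0 < f y}.indicator (fun y => G y i / f y) x = G x i / f x :=
      indicator_of_mem (s := {y : Phase d | 0 < f y}) h _
    rw [hi]
    have e : G x i = f x * (G x i / f x) := by field_simp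
    set v := G x i / f x
    rw [e]
    nlinarith [mul_nonneg h.le (sq_nonneg (v + x.2 i / m + pdP φ.1 x i))]

lemma IsWeakPGrad.le_relFisher {m : ℝ} (hm : 0 < m) {f : Phase d → ℝ} (hf : Integrable f)
    (hf0 : ∀ x, 0 ≤ f x) {G : Phase d → Fin d → ℝ} (hG : IsWeakPGrad f G) :
    ∫⁻ x, ENNReal.ofReal ((∑ i, (({y : Phase d | 0 < f y}.indicator
        (fun y => G y i / f y) x) + x.2 i / m) ^ 2) * f x)
      ≤ relFisher m (volume.withDensity fun x => ENNReal.ofReal (f x)) := by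
  by_cases hI : relFisher m (volume.withDensity fun x => ENNReal.ofReal (f x)) = ⊤
  · rw [hI]
    exact le_top
  obtain ⟨w, hw1, hw2, hw3, hw4⟩ := exists_score hm hf hf0
    fun φ hφ => le_toReal_relFisher hf hf0 hI hφ
  have hG' := isWeakPGrad_of_score hf.locallyIntegrable (fun i => (hw3 i).locallyIntegrable) hw4
  calc _ = ∫⁻ x, ENNReal.ofReal (f x * ∑ i, w x i ^ 2) := by
        refine lintegral_congr_ae ?_
        filter_upwards [hG.ae_eq hG'] with x hx
        congr 1
        rcases (hf0 x).eq_or_lt with h | h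
        · simp [← h]
        · rw [mul_comm]
          congr 1
          refine Finset.sum_congr rfl fun i _ => ?_
          rw [indicator_of_mem (s := {y : Phase d | 0 < f y}) h, hx i]
          field_simp
          ring
    _ = ENNReal.ofReal (∫ x, f x * ∑ i, w x i ^ 2) :=
        (ofReal_integral_eq_lintegral_ofReal hw1 (Eventually.of_forall fun x =>
          mul_nonneg (hf0 x) (Finset.sum_nonneg fun i _ => sq_nonneg _))).symm
    _ ≤ _ := ENNReal.ofReal_le_of_le_toReal hw2

end Duality

/-- Lemma 2.1, equivalence of relative-Fisher-Information expressions for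
absolutely continuous measures: if `ν = f dx` with `f ∈ L¹(ℝ^{2d})`, then
(i) whenever `∇_p f` exists distributionally in `L¹_loc` (as a function `G`),
`I(ν|μ) = ∫ |(∇_p f / f)·1_{f>0} + p/m|² f dx`; and
(ii) if no such distributional gradient exists, `I(ν|μ) = ∞`. -/
theorem stmt0 {d : ℕ} (hd : 1 ≤ d) {m : ℝ} (hm : 0 < m)
    (ν : Measure (Phase d)) [IsProbabilityMeasure ν]
    (f : Phase d → ℝ) (hf_int : Integrable f volume) (hf_nonneg : ∀ x, 0 ≤ f x)
    (hν : ν = volume.withDensity (fun x => ENNReal.ofReal (f x))) :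
    (∀ G : Phase d → Fin d → ℝ, IsWeakPGrad f G →
      relFisher m ν = ∫⁻ x, ENNReal.ofReal
        ((∑ i, (({y : Phase d | 0 < f y}.indicator (fun y => G y i / f y) x)
            + x.2 i / m) ^ 2) * f x) ∂volume)
    ∧ ((¬ ∃ G : Phase d → Fin d → ℝ, IsWeakPGrad f G) → relFisher m ν = ⊤) := by
  subst hν
  refine ⟨fun G hG => le_antisymm (hG.relFisher_le hf_int hf_nonneg)
    (hG.le_relFisher hm hf_int hf_nonneg), fun hne => ?_⟩
  by_contra hI
  obtain ⟨w, -, -, hw, hw'⟩ := exists_score hm hf_int hf_nonneg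
    fun φ hφ => le_toReal_relFisher hf_int hf_nonneg hI hφ
  exact hne ⟨_, isWeakPGrad_of_score hf_int.locallyIntegrable
    (fun i => (hw i).locallyIntegrable) hw'⟩
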